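/- arXiv:2011.06663 — 12 statements merged into one kernel-verified Lean document; each statement's English description precedes it below -/
import Mathlib

section
/- Define η*(w) := (1/n)·√(v(w)/c(w))·K/S for each w ∈ Ω. Then: (i) η*(w) > 0 for every w ∈ Ω and η* satisfies the budget constraint; (ii) ∑_{w∈Ω} v(w)·p(w)/η*(w) = n·S²/K; and (iii) for every second-phase design η satisfying the budget constraint, ∑_{w∈Ω} v(w)·p(w)/η*(w) ≤ ∑_{w∈Ω} v(w)·p(w)/η(w). (This is the optimality part of Theorem 1 for discrete auxiliary covariates: η* minimizes the design-dependent part of the asymptotic variance among all budget-feasible second-phase designs.) -/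
/-- optimality part of Theorem 1, discrete auxiliary covariates:
`ηstar w = (1/n)·√(v w / c w)·K/S` is strictly positive, satisfies the budget
constraint, attains objective value `n·S²/K`, and minimizes the design-dependent
part `∑ w, v w · p w / η w` of the asymptotic variance among all strictly
positive budget-feasible second-phase designs `η`. -/
theorem optimal_two_phase_design
    {Ω : Type*} [Fintype Ω] [Nonempty Ω]
    (p v c : Ω → ℝ)
    (hp : ∀ w, 0 < p w) (hpsum : ∑ w, p w = 1)
    (hv : ∀ w, 0 < v w) (hc : ∀ w, 0 < c w)
    (B C₀ C₁ n nₑ K S : ℝ)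
    (hC₁ : 0 < C₁) (hn : 0 < n)
    (hK : K = B - C₀ - nₑ * C₁) (hKpos : 0 < K)
    (hS : S = ∑ w, Real.sqrt (c w * v w) * p w)
    (ηstar : Ω → ℝ)
    (hηstar : ∀ w, ηstar w = (1 / n) * Real.sqrt (v w / c w) * K / S) :
    ((∀ w, 0 < ηstar w) ∧
      C₀ + nₑ * C₁ + n * ∑ w, ηstar w * c w * p w = B) ∧
    (∑ w, v w * p w / ηstar w = n * S ^ 2 / K) ∧
    (∀ η : Ω → ℝ, (∀ w, 0 < η w) →
      C₀ + nₑ * C₁ + n * ∑ w, η w * c w * p w = B →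
      ∑ w, v w * p w / ηstar w ≤ ∑ w, v w * p w / η w) := by
  have hab : ∀ w, Real.sqrt (c w * v w) = Real.sqrt (c w) * Real.sqrt (v w) :=
    fun w => Real.sqrt_mul (hc w).le _
  have hdiv : ∀ w, Real.sqrt (v w / c w) = Real.sqrt (v w) / Real.sqrt (c w) :=
    fun w => Real.sqrt_div (hv w).le _
  have ha : ∀ w, 0 < Real.sqrt (c w) := fun w => Real.sqrt_pos.2 (hc w)
  have hb : ∀ w, 0 < Real.sqrt (v w) := fun w => Real.sqrt_pos.2 (hv w)
  have ha2 : ∀ w, Real.sqrt (c w) ^ 2 = c w := fun w => Real.sq_sqrt (hc w).le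
  have hb2 : ∀ w, Real.sqrt (v w) ^ 2 = v w := fun w => Real.sq_sqrt (hv w).le
  have hSpos : 0 < S := by
    rw [hS]
    refine Finset.sum_pos (fun w _ => ?_) Finset.univ_nonempty
    rw [hab]
    exact mul_pos (mul_pos (ha w) (hb w)) (hp w)
  have hval : ∑ w, v w * p w / ηstar w = n * S ^ 2 / K := by
    have h : ∀ w, v w * p w / ηstar w = (n * S / K) * (Real.sqrt (c w * v w) * p w) := by
      intro w
      have h1 := ha w
      have h2 := hb w
      rw [hηstar, hab, hdiv]
      nth_rewrite 1 [← hb2 w]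
      field_simp
    rw [Finset.sum_congr rfl (fun w _ => h w), ← Finset.mul_sum, ← hS]
    ring
  refine ⟨⟨fun w => ?_, ?_⟩, hval, ?_⟩
  · have h1 := ha w
    have h2 := hb w
    rw [hηstar, hdiv]
    positivity
  · have h : ∀ w, ηstar w * c w * p w = (K / (n * S)) * (Real.sqrt (c w * v w) * p w) := by
      intro w
      have h1 := ha w
      have h2 := hb w
      rw [hηstar, hab, hdiv]
      nth_rewrite 2 [← ha2 w]
      field_simp
    rw [Finset.sum_congr rfl (fun w _ => h w), ← Finset.mul_sum, ← hS]
    have : n * (K / (n * S) * S) = K := by field_simp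
    rw [this, hK]
    ring
  · intro η hη hbud
    rw [hval]
    have hcost : ∑ w, η w * c w * p w = K / n := by
      rw [eq_div_iff hn.ne']
      linarith
    have h : ∀ w, 2 * (n * S / K) * (Real.sqrt (c w * v w) * p w)
        - (n * S / K) ^ 2 * (η w * c w * p w) ≤ v w * p w / η w := by
      intro w
      have h3 := hη w
      rw [le_div_iff₀ h3, hab]
      have h4 := mul_nonneg (hp w).le
        (sq_nonneg (Real.sqrt (v w) - (n * S / K) * η w * Real.sqrt (c w)))
      have h5 : p w * (Real.sqrt (v w) - (n * S / K) * η w * Real.sqrt (c w)) ^ 2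
          = p w * (Real.sqrt (v w) ^ 2 - 2 * (n * S / K) * η w * Real.sqrt (c w) * Real.sqrt (v w)
            + (n * S / K) ^ 2 * η w ^ 2 * Real.sqrt (c w) ^ 2) := by ring
      rw [h5, ha2, hb2] at h4
      linarith
    have hs := Finset.sum_le_sum (s := Finset.univ) (fun w _ => h w)
    rw [Finset.sum_sub_distrib, ← Finset.mul_sum, ← Finset.mul_sum, ← hS, hcost] at hs
    have e : 2 * (n * S / K) * S - (n * S / K) ^ 2 * (K / n) = n * S ^ 2 / K := by
      field_simp
      ring
    linarith
end

section
/- Let η₁ : Ω → ℝ satisfy 0 < η₁(w) ≤ 1 for all w ∈ Ω (η₁(w) plays the role of the first-phase selection probability λ₁ at w), and define η*(w) := (1/n)·√(v(w)/c(w))·K/S. If n_e satisfies (B − C₀ − (min_{w∈Ω} n·η₁(w)·√(c(w)/v(w)))·S)/C₁ ≤ n_e < (B − C₀)/C₁, then 0 < η*(w) ≤ η₁(w) for every w ∈ Ω, i.e., the optimal design of Theorem 1 is feasible (the induced second-phase sampling probability λ₂*(w) = η*(w)/η₁(w) lies in (0,1]). -/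
/-- feasibility range of the first-phase sample size, Theorem 1:
if `η₁ : Ω → (0,1]` are the first-phase selection probabilities and the
first-phase sample size `nₑ` satisfies
`(B − C₀ − (min_w n·η₁(w)·√(c w / v w))·S)/C₁ ≤ nₑ < (B − C₀)/C₁`, then the
optimal design `ηstar w = (1/n)·√(v w / c w)·K/S` satisfies
`0 < ηstar w ≤ η₁ w` for every `w`, i.e. the induced second-phase sampling
probability `λ₂*(w) = ηstar w / η₁ w` lies in `(0,1]`. -/
theorem optimal_design_feasible
    {Ω : Type*} [Fintype Ω] [Nonempty Ω]
    (p v c : Ω → ℝ)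
    (hp : ∀ w, 0 < p w) (hpsum : ∑ w, p w = 1)
    (hv : ∀ w, 0 < v w) (hc : ∀ w, 0 < c w)
    (B C₀ C₁ n nₑ K S : ℝ)
    (hC₁ : 0 < C₁) (hn : 0 < n)
    (hK : K = B - C₀ - nₑ * C₁) (hKpos : 0 < K)
    (hS : S = ∑ w, Real.sqrt (c w * v w) * p w)
    (η₁ : Ω → ℝ) (hη₁ : ∀ w, 0 < η₁ w ∧ η₁ w ≤ 1)
    (hne_lo : (B - C₀ -
        (Finset.univ.inf' Finset.univ_nonempty
          (fun w => n * η₁ w * Real.sqrt (c w / v w))) * S) / C₁ ≤ nₑ)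
    (hne_hi : nₑ < (B - C₀) / C₁)
    (ηstar : Ω → ℝ)
    (hηstar : ∀ w, ηstar w = (1 / n) * Real.sqrt (v w / c w) * K / S) :
    ∀ w, 0 < ηstar w ∧ ηstar w ≤ η₁ w := by
  intro w
  have hSpos : 0 < S := by
    rw [hS]
    exact Finset.sum_pos
      (fun w _ => mul_pos (Real.sqrt_pos.mpr (mul_pos (hc w) (hv w))) (hp w))
      Finset.univ_nonempty
  have hr : 0 < Real.sqrt (v w / c w) := Real.sqrt_pos.mpr (div_pos (hv w) (hc w))
  have hrr : Real.sqrt (v w / c w) * Real.sqrt (c w / v w) = 1 := by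
    rw [← Real.sqrt_mul (div_pos (hv w) (hc w)).le]
    have h1 := (hv w).ne'
    have h2 := (hc w).ne'
    have : v w / c w * (c w / v w) = 1 := by field_simp
    rw [this, Real.sqrt_one]
  have hmin := Finset.inf'_le (fun w => n * η₁ w * Real.sqrt (c w / v w)) (Finset.mem_univ w)
  rw [div_le_iff₀ hC₁] at hne_lo
  have hKle : K ≤ n * η₁ w * Real.sqrt (c w / v w) * S := by
    have := mul_le_mul_of_nonneg_right hmin hSpos.le
    linarith
  rw [hηstar w]
  refine ⟨by positivity, ?_⟩
  rw [div_le_iff₀ hSpos]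
  calc 1 / n * Real.sqrt (v w / c w) * K
      ≤ 1 / n * Real.sqrt (v w / c w) * (n * η₁ w * Real.sqrt (c w / v w) * S) :=
        mul_le_mul_of_nonneg_left hKle (by positivity)
    _ = (1 / n * n) * (Real.sqrt (v w / c w) * Real.sqrt (c w / v w)) * (η₁ w * S) := by ring
    _ = η₁ w * S := by rw [hrr, one_div_mul_cancel hn.ne']; ring
end

section
/- Let a ≥ 0 be a real constant (playing the role of PVE·Var(Y) + E' in Corollary 1), and set C̄ := ∑_{w∈Ω} c(w)·p(w) and V̄ := ∑_{w∈Ω} v(w)·p(w). Then the relative efficiency of the optimal second-phase design versus simple random second-phase sampling satisfies RE = (a + (n/K)·S²) / (a + (n/K)·C̄·V̄) ≤ 1 (the denominator being strictly positive). This is Corollary 1: the proposed optimal auxiliary-dependent sampling design is at least as efficient as simple random sampling in the second phase. -/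
/-- Corollary 1: with `a ≥ 0` playing the role of
`PVE·Var(Y) + E'`, `C̄ = ∑ c·p` and `V̄ = ∑ v·p`, the relative efficiency of
the optimal second-phase design versus simple random second-phase sampling is
`RE = (a + (n/K)·S²)/(a + (n/K)·C̄·V̄) ≤ 1`, the denominator being strictly
positive. -/
theorem relative_efficiency_optimal_vs_random
    {Ω : Type*} [Fintype Ω] [Nonempty Ω]
    (p v c : Ω → ℝ)
    (hp : ∀ w, 0 < p w) (hpsum : ∑ w, p w = 1)
    (hv : ∀ w, 0 < v w) (hc : ∀ w, 0 < c w)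
    (B C₀ C₁ n nₑ K S : ℝ)
    (hC₁ : 0 < C₁) (hn : 0 < n)
    (hK : K = B - C₀ - nₑ * C₁) (hKpos : 0 < K)
    (hS : S = ∑ w, Real.sqrt (c w * v w) * p w)
    (a : ℝ) (ha : 0 ≤ a)
    (Cbar Vbar : ℝ)
    (hCbar : Cbar = ∑ w, c w * p w)
    (hVbar : Vbar = ∑ w, v w * p w) :
    0 < a + (n / K) * Cbar * Vbar ∧
      (a + (n / K) * S ^ 2) / (a + (n / K) * Cbar * Vbar) ≤ 1 := by
  have hC : 0 < Cbar := by
    rw [hCbar]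
    exact Finset.sum_pos (fun w _ => mul_pos (hc w) (hp w)) Finset.univ_nonempty
  have hV : 0 < Vbar := by
    rw [hVbar]
    exact Finset.sum_pos (fun w _ => mul_pos (hv w) (hp w)) Finset.univ_nonempty
  have hnK : 0 < n / K := div_pos hn hKpos
  have hpos : 0 < a + (n / K) * Cbar * Vbar := by positivity
  have hCS : S ^ 2 ≤ Cbar * Vbar := by
    rw [hS, hCbar, hVbar]
    refine Finset.sum_sq_le_sum_mul_sum_of_sq_eq_mul _
      (fun w _ => (mul_pos (hc w) (hp w)).le) (fun w _ => (mul_pos (hv w) (hp w)).le) ?_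
    intro w _
    rw [mul_pow, Real.sq_sqrt (mul_pos (hc w) (hv w)).le]
    ring
  refine ⟨hpos, ?_⟩
  rw [div_le_one hpos, mul_assoc]
  have := mul_le_mul_of_nonneg_left hCS hnK.le
  linarith
end

section
/- Let Ω₀ be a nonempty finite set (the support of W₀), p₀ a probability mass function on Ω₀ with p₀(w₀) > 0 for all w₀, v₁ : Ω₀ → ℝ nonnegative (v₁(w₀) plays the role of Var(Y | W₀ = w₀) − E[Var(Y | W̄₁, R₁ = 1) | W₀ = w₀]), λ₁ : Ω₀ → ℝ with 0 < λ₁(w₀) ≤ 1 (first-phase selection probabilities), and λ₁' ∈ (0,1] a constant with λ₁(w₀) ≤ λ₁' for all w₀ (the subsampled new first-phase design). Let a ≥ 0 (playing the role of PVE·Var(Y)), let n_e' ≤ n_e with K' := B − C₀ − n_e'·C₁ (so K' ≥ K > 0), and set C̄ := ∑_{w∈Ω} c(w)·p(w), V̄ := ∑_{w∈Ω} v(w)·p(w), E' := ∑_{w₀∈Ω₀} v₁(w₀)·p₀(w₀)/λ₁(w₀), E''' := ∑_{w₀∈Ω₀} v₁(w₀)·p₀(w₀)/λ₁'. Then the relative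 efficiency of the alternative two-phase sampling design versus the simple random second-phase design satisfies RE = (a + E''' + (n/K')·S²) / (a + E' + (n/K)·C̄·V̄) ≤ 1. (This is Corollary 2.) -/
/-- Corollary 2: the relative efficiency of the alternative
two-phase sampling design (an unbiased new first-phase sample with constant
selection probability `lam₁' ≥ lam₁(w₀)` and size `nₑ' ≤ nₑ`) versus the
simple random second-phase design satisfies
`RE = (a + E''' + (n/K')·S²)/(a + E' + (n/K)·C̄·V̄) ≤ 1`. -/
theorem relative_efficiency_alternative_design
    {Ω : Type*} [Fintype Ω] [Nonempty Ω]
    (p v c : Ω → ℝ)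
    (hp : ∀ w, 0 < p w) (hpsum : ∑ w, p w = 1)
    (hv : ∀ w, 0 < v w) (hc : ∀ w, 0 < c w)
    (B C₀ C₁ n nₑ K S : ℝ)
    (hC₁ : 0 < C₁) (hn : 0 < n)
    (hK : K = B - C₀ - nₑ * C₁) (hKpos : 0 < K)
    (hS : S = ∑ w, Real.sqrt (c w * v w) * p w)
    {Ω₀ : Type*} [Fintype Ω₀] [Nonempty Ω₀]
    (p₀ : Ω₀ → ℝ) (hp₀ : ∀ w₀, 0 < p₀ w₀) (hp₀sum : ∑ w₀, p₀ w₀ = 1)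
    (v₁ : Ω₀ → ℝ) (hv₁ : ∀ w₀, 0 ≤ v₁ w₀)
    (lam₁ : Ω₀ → ℝ) (hlam₁ : ∀ w₀, 0 < lam₁ w₀ ∧ lam₁ w₀ ≤ 1)
    (lam₁' : ℝ) (hlam₁' : 0 < lam₁' ∧ lam₁' ≤ 1)
    (hlam₁le : ∀ w₀, lam₁ w₀ ≤ lam₁')
    (a : ℝ) (ha : 0 ≤ a)
    (nₑ' K' : ℝ) (hne' : nₑ' ≤ nₑ) (hK' : K' = B - C₀ - nₑ' * C₁)
    (Cbar Vbar E' E''' : ℝ)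
    (hCbar : Cbar = ∑ w, c w * p w)
    (hVbar : Vbar = ∑ w, v w * p w)
    (hE' : E' = ∑ w₀, v₁ w₀ * p₀ w₀ / lam₁ w₀)
    (hE''' : E''' = ∑ w₀, v₁ w₀ * p₀ w₀ / lam₁') :
    (a + E''' + (n / K') * S ^ 2) / (a + E' + (n / K) * Cbar * Vbar) ≤ 1 := by
  have hKK : K ≤ K' := by
    have := mul_le_mul_of_nonneg_right hne' hC₁.le
    linarith
  have hCS : S ^ 2 ≤ Cbar * Vbar := by
    rw [hS, hCbar, hVbar]
    refine Finset.sum_sq_le_sum_mul_sum_of_sq_eq_mul _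
      (fun w _ => (mul_pos (hc w) (hp w)).le) (fun w _ => (mul_pos (hv w) (hp w)).le) ?_
    intro w _
    rw [mul_pow, Real.sq_sqrt (mul_pos (hc w) (hv w)).le]
    ring
  have hE : E''' ≤ E' := by
    rw [hE', hE''']
    refine Finset.sum_le_sum fun w _ => ?_
    exact div_le_div_of_nonneg_left (mul_nonneg (hv₁ w) (hp₀ w).le) (hlam₁ w).1 (hlam₁le w)
  have hE0 : 0 ≤ E' := by
    rw [hE']
    exact Finset.sum_nonneg fun w _ =>
      div_nonneg (mul_nonneg (hv₁ w) (hp₀ w).le) (hlam₁ w).1.le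
  have hnK : n / K' ≤ n / K := div_le_div_of_nonneg_left hn.le hKpos hKK
  have hnK0 : 0 ≤ n / K := (div_pos hn hKpos).le
  have h1 : n / K' * S ^ 2 ≤ n / K * Cbar * Vbar := by
    rw [mul_assoc]
    exact mul_le_mul hnK hCS (sq_nonneg _) hnK0
  have h0 : 0 ≤ n / K * Cbar * Vbar := by
    rw [mul_assoc]
    exact mul_nonneg hnK0 ((sq_nonneg S).trans hCS)
  exact div_le_one_of_le₀ (by linarith) (by linarith)
end

section
/- For any cost function C₂ : Ω → ℝ, E[C₂(W̄₁)·1{R₂ = 1}] = E[λ₁(W₀)·λ₂(W̄₁)·C₂(W̄₁)]; consequently, if P(R₂ = 1) > 0, the expected per-person cost of measuring the outcome in the second phase is E[C₂(W̄₁) | R₂ = 1] = E[λ₁(W₀)·λ₂(W̄₁)·C₂(W̄₁)] / P(R₂ = 1). (This is the expected-cost identity of Appendix A.) -/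
/-- Probability of an event `A` under the finite probability mass function `P`. -/
noncomputable def prb {Ωs : Type*} [Fintype Ωs] (P : Ωs → ℝ) (A : Set Ωs) : ℝ :=
  ∑ s, A.indicator P s

/-- Expectation `E[Z]` under `P`. -/
noncomputable def expv {Ωs : Type*} [Fintype Ωs] (P : Ωs → ℝ) (Z : Ωs → ℝ) : ℝ :=
  ∑ s, P s * Z s

/-- Conditional expectation `E[Z ∣ A] = E[Z·1_A]/P(A)`. -/
noncomputable def cexpv {Ωs : Type*} [Fintype Ωs] (P : Ωs → ℝ) (Z : Ωs → ℝ) (A : Set Ωs) : ℝ :=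
  (∑ s, A.indicator (fun s => P s * Z s) s) / prb P A

/-- Conditional probability `P(B ∣ A) = P(B ∩ A)/P(A)`. -/
noncomputable def cprb {Ωs : Type*} [Fintype Ωs] (P : Ωs → ℝ) (B A : Set Ωs) : ℝ :=
  prb P (B ∩ A) / prb P A

/-- expected-cost identity of Appendix A: for any cost function
`C₂ : Ω → ℝ`, `E[C₂(W̄₁)·1{R₂=1}] = E[λ₁(W₀)·λ₂(W̄₁)·C₂(W̄₁)]`; consequently,
if `P(R₂=1) > 0`, the expected per-person cost of measuring the outcome in the
second phase is `E[C₂(W̄₁) ∣ R₂=1] = E[λ₁(W₀)·λ₂(W̄₁)·C₂(W̄₁)]/P(R₂=1)`. -/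
theorem expected_second_phase_cost
    {Ωs Ω₀ Ω : Type*} [Fintype Ωs] [Fintype Ω₀] [Fintype Ω]
    [Nonempty Ω₀] [Nonempty Ω]
    (P : Ωs → ℝ) (hP : ∀ s, 0 ≤ P s) (hPsum : ∑ s, P s = 1)
    (π : Ω → Ω₀) (W : Ωs → Ω) (Y : Ωs → ℝ)
    (R₁ R₂ : Ωs → ℝ)
    (hR₁ : ∀ s, R₁ s = 0 ∨ R₁ s = 1) (hR₂ : ∀ s, R₂ s = 0 ∨ R₂ s = 1)
    (hR₂₁ : ∀ s, R₂ s ≤ R₁ s)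
    (lam₁ : Ω₀ → ℝ) (lam₂ : Ω → ℝ)
    (hlam₁ : ∀ w₀, 0 < lam₁ w₀ ∧ lam₁ w₀ ≤ 1)
    (hlam₂ : ∀ w, 0 < lam₂ w ∧ lam₂ w ≤ 1)
    (hMAR₁ : ∀ (w : Ω) (y : ℝ), 0 < prb P {s | W s = w ∧ Y s = y} →
      cprb P {s | R₁ s = 1} {s | W s = w ∧ Y s = y} = lam₁ (π w))
    (hMAR₂ : ∀ (w : Ω) (y : ℝ), 0 < prb P {s | W s = w ∧ Y s = y} →
      cprb P {s | R₂ s = 1} {s | R₁ s = 1 ∧ W s = w ∧ Y s = y} = lam₂ w)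
    (C₂ : Ω → ℝ) :
    expv P (fun s => C₂ (W s) * R₂ s)
      = expv P (fun s => lam₁ (π (W s)) * lam₂ (W s) * C₂ (W s)) ∧
    (0 < prb P {s | R₂ s = 1} →
      cexpv P (fun s => C₂ (W s)) {s | R₂ s = 1}
        = expv P (fun s => lam₁ (π (W s)) * lam₂ (W s) * C₂ (W s))
          / prb P {s | R₂ s = 1}) := by
  classical
  have key : ∀ (w : Ω) (y : ℝ),
      ∑ s, (if W s = w ∧ Y s = y then P s * R₂ s else 0)
        = lam₁ (π w) * lam₂ w * ∑ s, (if W s = w ∧ Y s = y then P s else 0) := by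
    intro w y
    have hA : prb P {s | W s = w ∧ Y s = y} = ∑ s, (if W s = w ∧ Y s = y then P s else 0) := by
      unfold prb
      refine Finset.sum_congr rfl fun s _ => ?_
      simp [Set.indicator_apply]
    have hB : prb P ({s | R₂ s = 1} ∩ {s | R₁ s = 1 ∧ W s = w ∧ Y s = y})
        = ∑ s, (if W s = w ∧ Y s = y then P s * R₂ s else 0) := by
      unfold prb
      refine Finset.sum_congr rfl fun s _ => ?_
      have h21 := hR₂₁ s
      rcases hR₂ s with h2 | h2
      · simp [Set.indicator_apply, h2]
      · have h1 : R₁ s = 1 := by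
          rcases hR₁ s with h1 | h1
          · rw [h1, h2] at h21
            norm_num at h21
          · exact h1
        simp [Set.indicator_apply, h2, h1]
    have hI : ({s | R₁ s = 1} ∩ {s | W s = w ∧ Y s = y} : Set Ωs)
        = {s | R₁ s = 1 ∧ W s = w ∧ Y s = y} := rfl
    have hnn : ∀ s ∈ Finset.univ, 0 ≤ (if W s = w ∧ Y s = y then P s else 0) := by
      intro s _
      split_ifs
      · exact hP s
      · exact le_rfl
    rcases (Finset.sum_nonneg hnn).eq_or_lt with h0 | hpos
    · rw [← h0, mul_zero]
      have hz := (Finset.sum_eq_zero_iff_of_nonneg hnn).1 h0.symm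
      refine Finset.sum_eq_zero fun s hs => ?_
      have := hz s hs
      split_ifs at this ⊢ with hc
      · rw [this, zero_mul]
      · rfl
    · rw [← hA] at hpos
      have e1 := hMAR₁ w y hpos
      have e2 := hMAR₂ w y hpos
      unfold cprb at e1 e2
      rw [hI, div_eq_iff hpos.ne'] at e1
      have hne : prb P {s | R₁ s = 1 ∧ W s = w ∧ Y s = y} ≠ 0 := by
        rw [e1]
        exact (mul_pos (hlam₁ _).1 hpos).ne'
      rw [div_eq_iff hne, hB, e1] at e2
      rw [e2, ← hA]
      ring
  have fib : ∀ f : Ωs → ℝ, ∑ s, f s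
      = ∑ p ∈ Finset.univ.image (fun s => (W s, Y s)),
          ∑ s, (if W s = p.1 ∧ Y s = p.2 then f s else 0) := by
    intro f
    rw [← Finset.sum_fiberwise_of_maps_to (s := Finset.univ)
      (t := Finset.univ.image (fun s => (W s, Y s))) (g := fun s => (W s, Y s))
      (fun s hs => Finset.mem_image_of_mem _ hs)]
    refine Finset.sum_congr rfl fun p _ => ?_
    rw [Finset.sum_filter]
    refine Finset.sum_congr rfl fun s _ => ?_
    simp [Prod.ext_iff]
  have main : expv P (fun s => C₂ (W s) * R₂ s)
      = expv P (fun s => lam₁ (π (W s)) * lam₂ (W s) * C₂ (W s)) := by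
    unfold expv
    rw [fib, fib (fun s => P s * (lam₁ (π (W s)) * lam₂ (W s) * C₂ (W s)))]
    refine Finset.sum_congr rfl fun p _ => ?_
    have e := congrArg (fun x => C₂ p.1 * x) (key p.1 p.2)
    simp only [← mul_assoc, Finset.mul_sum] at e
    refine Eq.trans ?_ (e.trans ?_)
    · refine Finset.sum_congr rfl fun s _ => ?_
      split_ifs with hc
      · beta_reduce; rw [hc.1]; ring
      · ring
    · refine Finset.sum_congr rfl fun s _ => ?_
      split_ifs with hc
      · rw [hc.1]; ring
      · ring
  refine ⟨main, fun _ => ?_⟩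
  rw [← main]
  unfold cexpv expv
  congr 1
  refine Finset.sum_congr rfl fun s _ => ?_
  rcases hR₂ s with h2 | h2 <;> simp [Set.indicator_apply, h2]
end

section
/- For every pair of functions g₀ : Ω₀ → ℝ and g₁ : Ω → ℝ (arbitrary, possibly misspecified outcome models) and every β ∈ ℝ, E[ R₂/(λ₁(W₀)·λ₂(W̄₁))·(Y − β) − ((R₁ − λ₁(W₀))/λ₁(W₀))·(g₀(W₀) − β) − ((R₂ − λ₂(W̄₁)·R₁)/(λ₁(W₀)·λ₂(W̄₁)))·(g₁(W̄₁) − β) ] = E[Y] − β. In particular, the two-phase estimating function U(Y, W̄₁; β) of equation (3) has mean zero if and only if β = E[Y], regardless of whether g₀ and g₁ equal the true conditional means E(Y | W₀) and E(Y | W̄₁, R₁ = 1). -/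
/-- Conditional variance `Var(Z ∣ A) = E[Z² ∣ A] − (E[Z ∣ A])²`. -/
noncomputable def cvarv {Ωs : Type*} [Fintype Ωs] (P : Ωs → ℝ) (Z : Ωs → ℝ) (A : Set Ωs) : ℝ :=
  cexpv P (fun s => Z s ^ 2) A - (cexpv P Z A) ^ 2

/-- Variance `Var(Z) = E[Z²] − (E[Z])²`. -/
noncomputable def varv {Ωs : Type*} [Fintype Ωs] (P : Ωs → ℝ) (Z : Ωs → ℝ) : ℝ :=
  expv P (fun s => Z s ^ 2) - (expv P Z) ^ 2

theorem aux_fiber {Ωs κ : Type*} [Fintype Ωs] (P D : Ωs → ℝ) (V : Ωs → κ) (h : κ → ℝ)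
    (hD : ∀ k, ∑ s, {s | V s = k}.indicator (fun s => P s * D s) s = 0) :
    ∑ s, P s * D s * h (V s) = 0 := by
  classical
  rw [← Finset.sum_fiberwise_of_maps_to (s := Finset.univ) (t := Finset.univ.image V) (g := V)
    (fun s hs => Finset.mem_image_of_mem V hs)]
  refine Finset.sum_eq_zero fun k _ => ?_
  have := hD k
  simp only [Set.indicator_apply, Set.mem_setOf_eq, ← Finset.sum_filter] at this
  calc _ = ∑ s ∈ Finset.univ.filter (fun s => V s = k), P s * D s * h k := by
        refine Finset.sum_congr rfl fun s hs => ?_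
        rw [(Finset.mem_filter.1 hs).2]
    _ = 0 := by rw [← Finset.sum_mul, this, zero_mul]

/-- unbiasedness of the two-phase estimating function, eq. (3):
for arbitrary (possibly misspecified) outcome models `g₀, g₁` and every `β`,
`E[U(Y, W̄₁; β)] = E[Y] − β`; in particular `E[U] = 0 ↔ β = E[Y]`. -/
theorem two_phase_estimating_function_unbiased
    {Ωs Ω₀ Ω : Type*} [Fintype Ωs] [Fintype Ω₀] [Fintype Ω]
    [Nonempty Ω₀] [Nonempty Ω]
    (P : Ωs → ℝ) (hP : ∀ s, 0 ≤ P s) (hPsum : ∑ s, P s = 1)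
    (π : Ω → Ω₀) (W : Ωs → Ω) (Y : Ωs → ℝ)
    (R₁ R₂ : Ωs → ℝ)
    (hR₁ : ∀ s, R₁ s = 0 ∨ R₁ s = 1) (hR₂ : ∀ s, R₂ s = 0 ∨ R₂ s = 1)
    (hR₂₁ : ∀ s, R₂ s ≤ R₁ s)
    (lam₁ : Ω₀ → ℝ) (lam₂ : Ω → ℝ)
    (hlam₁ : ∀ w₀, 0 < lam₁ w₀ ∧ lam₁ w₀ ≤ 1)
    (hlam₂ : ∀ w, 0 < lam₂ w ∧ lam₂ w ≤ 1)
    (hMAR₁ : ∀ (w : Ω) (y : ℝ), 0 < prb P {s | W s = w ∧ Y s = y} →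
      cprb P {s | R₁ s = 1} {s | W s = w ∧ Y s = y} = lam₁ (π w))
    (hMAR₂ : ∀ (w : Ω) (y : ℝ), 0 < prb P {s | W s = w ∧ Y s = y} →
      cprb P {s | R₂ s = 1} {s | R₁ s = 1 ∧ W s = w ∧ Y s = y} = lam₂ w)
    (g₀ : Ω₀ → ℝ) (g₁ : Ω → ℝ) (β : ℝ)
    (U : Ωs → ℝ)
    (hU : ∀ s, U s =
      R₂ s / (lam₁ (π (W s)) * lam₂ (W s)) * (Y s - β)
      - (R₁ s - lam₁ (π (W s))) / lam₁ (π (W s)) * (g₀ (π (W s)) - β)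
      - (R₂ s - lam₂ (W s) * R₁ s) / (lam₁ (π (W s)) * lam₂ (W s))
          * (g₁ (W s) - β)) :
    expv P U = expv P Y - β ∧ (expv P U = 0 ↔ β = expv P Y) := by
  classical
  have key : ∀ k : Ω × ℝ,
      (∑ s, {s | (W s, Y s) = k}.indicator (fun s => P s * (R₁ s - lam₁ (π (W s)))) s = 0) ∧
      (∑ s, {s | (W s, Y s) = k}.indicator
        (fun s => P s * (R₂ s - lam₁ (π (W s)) * lam₂ (W s))) s = 0) := by
    rintro ⟨w, y⟩
    have hnn : ∀ s, 0 ≤ Set.indicator {s | W s = w ∧ Y s = y} P s :=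
      fun s => Set.indicator_nonneg (fun s _ => hP s) s
    have h0 : 0 ≤ prb P {s | W s = w ∧ Y s = y} := Finset.sum_nonneg fun s _ => hnn s
    have e1 : ∑ s, {s | (W s, Y s) = (w, y)}.indicator (fun s => P s * (R₁ s - lam₁ (π (W s)))) s
        = prb P ({s | R₁ s = 1} ∩ {s | W s = w ∧ Y s = y})
          - lam₁ (π w) * prb P {s | W s = w ∧ Y s = y} := by
      unfold prb
      rw [Finset.mul_sum, ← Finset.sum_sub_distrib]
      refine Finset.sum_congr rfl fun s _ => ?_
      by_cases hc : W s = w ∧ Y s = y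
      · obtain ⟨rfl, rfl⟩ := hc
        rcases hR₁ s with h | h <;> simp [Set.indicator_apply, h] <;> ring
      · simp [Set.indicator_apply, hc]
    have e2 : ∑ s, {s | (W s, Y s) = (w, y)}.indicator
          (fun s => P s * (R₂ s - lam₁ (π (W s)) * lam₂ (W s))) s
        = prb P ({s | R₂ s = 1} ∩ {s | R₁ s = 1 ∧ W s = w ∧ Y s = y})
          - lam₁ (π w) * lam₂ w * prb P {s | W s = w ∧ Y s = y} := by
      unfold prb
      rw [Finset.mul_sum, ← Finset.sum_sub_distrib]
      refine Finset.sum_congr rfl fun s _ => ?_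
      by_cases hc : W s = w ∧ Y s = y
      · obtain ⟨rfl, rfl⟩ := hc
        have h21 := hR₂₁ s
        rcases hR₁ s with h | h <;> rcases hR₂ s with h' | h' <;> rw [h, h'] at h21 <;>
          first
          | (exfalso; linarith)
          | (simp [Set.indicator_apply, h, h'] <;> ring)
      · simp [Set.indicator_apply, hc]
    rw [e1, e2]
    rcases h0.lt_or_eq with hp | hp
    · have m1 := hMAR₁ w y hp
      have m2 := hMAR₂ w y hp
      unfold cprb at m1 m2
      rw [div_eq_iff hp.ne'] at m1
      have e3 : ({s | R₁ s = 1} ∩ {s | W s = w ∧ Y s = y}) =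
        {s | R₁ s = 1 ∧ W s = w ∧ Y s = y} := rfl
      rw [e3] at m1 ⊢
      have hq : prb P {s | R₁ s = 1 ∧ W s = w ∧ Y s = y} ≠ 0 := by
        rw [m1]; exact (mul_pos (hlam₁ _).1 hp).ne'
      rw [div_eq_iff hq] at m2
      rw [m2, m1]
      constructor <;> ring
    · have hz := (Finset.sum_eq_zero_iff_of_nonneg (fun s _ => hnn s)).1 hp.symm
      have hsub : ∀ A : Set Ωs, A ⊆ {s | W s = w ∧ Y s = y} → prb P A = 0 := by
        intro A hA
        refine Finset.sum_eq_zero fun s _ => ?_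
        by_cases hs : s ∈ A
        · have := hz s (Finset.mem_univ s)
          rw [Set.indicator_of_mem (hA hs)] at this
          rw [Set.indicator_of_mem hs, this]
        · exact Set.indicator_of_notMem hs _
      rw [hsub ({s | R₁ s = 1} ∩ {s | W s = w ∧ Y s = y}) (fun s hs => hs.2),
        hsub ({s | R₂ s = 1} ∩ {s | R₁ s = 1 ∧ W s = w ∧ Y s = y}) (fun s hs => hs.2.2), ← hp]
      simp
  have k1 := aux_fiber P (fun s => R₁ s - lam₁ (π (W s))) (fun s => (W s, Y s))
    (fun k => ((g₁ k.1 - β) - (g₀ (π k.1) - β)) / lam₁ (π k.1)) (fun k => (key k).1)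
  have k2 := aux_fiber P (fun s => R₂ s - lam₁ (π (W s)) * lam₂ (W s)) (fun s => (W s, Y s))
    (fun k => ((k.2 - β) - (g₁ k.1 - β)) / (lam₁ (π k.1) * lam₂ k.1)) (fun k => (key k).2)
  have main : expv P U = expv P Y - β := by
    have hb : β = ∑ s, P s * β := by rw [← Finset.sum_mul, hPsum, one_mul]
    have : expv P U - (expv P Y - ∑ s, P s * β) = 0 := by
      rw [← add_zero (0 : ℝ)]
      nth_rewrite 1 [← k1]
      rw [← k2]
      unfold expv
      rw [← Finset.sum_sub_distrib, ← Finset.sum_sub_distrib, ← Finset.sum_add_distrib]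
      refine Finset.sum_congr rfl fun s _ => ?_
      have a1 := (hlam₁ (π (W s))).1.ne'
      have a2 := (hlam₂ (W s)).1.ne'
      rw [hU s]
      field_simp
      ring
    rw [← hb] at this
    linarith
  refine ⟨main, ?_⟩
  rw [main]
  constructor <;> intro h <;> linarith
end

section
/- Let ℓ : Ω₀ → ℝ be any strictly positive function (a possibly misspecified first-phase selection model), and let g₀(w₀) := E[Y | W₀ = w₀] for w₀ in the support of W₀ and g₁(w) := E[Y | W̄₁ = w, R₁ = 1] for w in the support of W̄₁ (these conditional expectations are well-defined since λ₁ > 0). Then for every β ∈ ℝ, E[ R₂/(ℓ(W₀)·λ₂(W̄₁))·(Y − β) − ((R₁ − ℓ(W₀))/ℓ(W₀))·(g₀(W₀) − β) − ((R₂ − λ₂(W̄₁)·R₁)/(ℓ(W₀)·λ₂(W̄₁)))·(g₁(W̄₁) − β) ] = E[Y] − β. (This is the double-robustness property: with correctly specified outcome regression models, the estimating function remains unbiased for β = E[Y] even when the first-phase selection probability is misspecified.) -/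
open Classical in
lemma dr_fiber {Ωs κ : Type*} [Fintype Ωs] (K : Ωs → κ) (v : Ωs → ℝ)
    (h : ∀ k, ∑ s, (if K s = k then v s else 0) = 0) (f : κ → ℝ) :
    ∑ s, v s * f (K s) = 0 := by
  rw [← Finset.sum_fiberwise_of_maps_to (s := Finset.univ) (t := Finset.univ.image K) (g := K)
    (fun s _ => Finset.mem_image_of_mem K (Finset.mem_univ s))]
  refine Finset.sum_eq_zero fun k _ => ?_
  have h1 : ∑ s ∈ Finset.univ.filter (fun s => K s = k), v s * f (K s)
      = (∑ s, (if K s = k then v s else 0)) * f k := by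
    rw [← Finset.sum_filter, Finset.sum_mul]
    refine Finset.sum_congr rfl fun s hs => ?_
    rw [(Finset.mem_filter.mp hs).2]
  rw [h1, h k, zero_mul]

lemma dr_prb_cases {Ωs : Type*} [Fintype Ωs] (P : Ωs → ℝ) (hP : ∀ s, 0 ≤ P s) (A : Set Ωs) :
    0 < prb P A ∨ ∀ s ∈ A, P s = 0 := by
  have hn : ∀ s ∈ Finset.univ, 0 ≤ A.indicator P s :=
    fun s _ => Set.indicator_nonneg (fun s _ => hP s) s
  rcases (Finset.sum_nonneg hn).lt_or_eq with h | h
  · exact Or.inl h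
  · right
    intro s hs
    have := (Finset.sum_eq_zero_iff_of_nonneg hn).1 h.symm s (Finset.mem_univ s)
    rwa [Set.indicator_of_mem hs] at this

open Classical in
lemma dr_prb {Ωs : Type*} [Fintype Ωs] (P : Ωs → ℝ) (A B : Set Ωs) (c : ℝ)
    (hA : prb P A ≠ 0) (h : cprb P B A = c) :
    ∑ s, (if s ∈ A then P s * ((if s ∈ B then 1 else 0) - c) else 0) = 0 := by
  unfold cprb at h
  rw [div_eq_iff hA] at h
  have h2 : ∑ s, (if s ∈ A then P s * ((if s ∈ B then 1 else 0) - c) else 0)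
      = prb P (B ∩ A) - c * prb P A := by
    unfold prb
    rw [Finset.mul_sum, ← Finset.sum_sub_distrib]
    refine Finset.sum_congr rfl fun s _ => ?_
    by_cases h1 : s ∈ A <;> by_cases h2 : s ∈ B <;> simp [Set.indicator, h1, h2] <;> ring
  rw [h2, h, sub_self]

open Classical in
lemma dr_cexp {Ωs : Type*} [Fintype Ωs] (P Z : Ωs → ℝ) (A : Set Ωs) (c : ℝ)
    (hA : prb P A ≠ 0) (h : c = cexpv P Z A) :
    ∑ s, (if s ∈ A then P s * (Z s - c) else 0) = 0 := by
  unfold cexpv at h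
  rw [eq_div_iff hA] at h
  have h2 : ∑ s, (if s ∈ A then P s * (Z s - c) else 0)
      = (∑ s, A.indicator (fun s => P s * Z s) s) - c * prb P A := by
    unfold prb
    rw [Finset.mul_sum, ← Finset.sum_sub_distrib]
    refine Finset.sum_congr rfl fun s _ => ?_
    by_cases h1 : s ∈ A <;> simp [Set.indicator, h1] <;> ring
  rw [h2, h, sub_self]

/-- double robustness: with correctly specified outcome
regressions `g₀(w₀) = E[Y ∣ W₀ = w₀]` and `g₁(w) = E[Y ∣ W̄₁ = w, R₁ = 1]`,
the estimating function remains unbiased for `β = E[Y]` even when the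
first-phase selection probability `λ₁` is replaced by an arbitrary strictly
positive (possibly misspecified) model `ℓ`. -/
theorem two_phase_estimating_function_doubly_robust
    {Ωs Ω₀ Ω : Type*} [Fintype Ωs] [Fintype Ω₀] [Fintype Ω]
    [Nonempty Ω₀] [Nonempty Ω]
    (P : Ωs → ℝ) (hP : ∀ s, 0 ≤ P s) (hPsum : ∑ s, P s = 1)
    (π : Ω → Ω₀) (W : Ωs → Ω) (Y : Ωs → ℝ)
    (R₁ R₂ : Ωs → ℝ)
    (hR₁ : ∀ s, R₁ s = 0 ∨ R₁ s = 1) (hR₂ : ∀ s, R₂ s = 0 ∨ R₂ s = 1)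
    (hR₂₁ : ∀ s, R₂ s ≤ R₁ s)
    (lam₁ : Ω₀ → ℝ) (lam₂ : Ω → ℝ)
    (hlam₁ : ∀ w₀, 0 < lam₁ w₀ ∧ lam₁ w₀ ≤ 1)
    (hlam₂ : ∀ w, 0 < lam₂ w ∧ lam₂ w ≤ 1)
    (hMAR₁ : ∀ (w : Ω) (y : ℝ), 0 < prb P {s | W s = w ∧ Y s = y} →
      cprb P {s | R₁ s = 1} {s | W s = w ∧ Y s = y} = lam₁ (π w))
    (hMAR₂ : ∀ (w : Ω) (y : ℝ), 0 < prb P {s | W s = w ∧ Y s = y} →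
      cprb P {s | R₂ s = 1} {s | R₁ s = 1 ∧ W s = w ∧ Y s = y} = lam₂ w)
    (ℓ : Ω₀ → ℝ) (hℓ : ∀ w₀, 0 < ℓ w₀)
    (g₀ : Ω₀ → ℝ)
    (hg₀ : ∀ w₀, 0 < prb P {s | π (W s) = w₀} →
      g₀ w₀ = cexpv P Y {s | π (W s) = w₀})
    (g₁ : Ω → ℝ)
    (hg₁ : ∀ w, 0 < prb P {s | W s = w ∧ R₁ s = 1} →
      g₁ w = cexpv P Y {s | W s = w ∧ R₁ s = 1})
    (β : ℝ) :
    expv P (fun s =>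
      R₂ s / (ℓ (π (W s)) * lam₂ (W s)) * (Y s - β)
      - (R₁ s - ℓ (π (W s))) / ℓ (π (W s)) * (g₀ (π (W s)) - β)
      - (R₂ s - lam₂ (W s) * R₁ s) / (ℓ (π (W s)) * lam₂ (W s))
          * (g₁ (W s) - β))
      = expv P Y - β := by
  classical
  have L1 : ∀ f : Ω × ℝ → ℝ, ∑ s, (P s * (R₁ s - lam₁ (π (W s)))) * f (W s, Y s) = 0 := by
    refine dr_fiber (fun s => (W s, Y s)) _ ?_
    rintro ⟨w, y⟩
    rcases dr_prb_cases P hP {s | W s = w ∧ Y s = y} with h | h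
    · refine Eq.trans ?_ (dr_prb P _ _ _ h.ne' (hMAR₁ w y h))
      refine Finset.sum_congr rfl fun s _ => ?_
      by_cases hw : W s = w <;> by_cases hy : Y s = y <;>
        rcases hR₁ s with h1 | h1 <;> simp [hw, hy, h1]
    · refine Finset.sum_eq_zero fun s _ => ?_
      by_cases hw : W s = w ∧ Y s = y
      · simp [h s hw]
      · simp [hw]
  have L2 : ∀ f : Ω × ℝ → ℝ, ∑ s, (P s * (R₂ s - lam₂ (W s) * R₁ s)) * f (W s, Y s) = 0 := by
    refine dr_fiber (fun s => (W s, Y s)) _ ?_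
    rintro ⟨w, y⟩
    rcases dr_prb_cases P hP {s | W s = w ∧ Y s = y} with h | h
    · have h2 := hMAR₂ w y h
      have hne : prb P {s | R₁ s = 1 ∧ W s = w ∧ Y s = y} ≠ 0 := by
        intro h0
        unfold cprb at h2
        rw [h0, div_zero] at h2
        exact (hlam₂ w).1.ne h2
      refine Eq.trans ?_ (dr_prb P _ _ _ hne h2)
      refine Finset.sum_congr rfl fun s _ => ?_
      have h21 := hR₂₁ s
      by_cases hw : W s = w <;> by_cases hy : Y s = y <;>
        rcases hR₁ s with h1 | h1 <;> rcases hR₂ s with h3 | h3 <;>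
        first
        | (rw [h1, h3] at h21; norm_num at h21; done)
        | simp [hw, hy, h1, h3]
    · refine Finset.sum_eq_zero fun s _ => ?_
      by_cases hw : W s = w ∧ Y s = y
      · simp [h s hw]
      · simp [hw]
  have L4 : ∀ f : Ω₀ → ℝ, ∑ s, (P s * (Y s - g₀ (π (W s)))) * f (π (W s)) = 0 := by
    refine dr_fiber (fun s => π (W s)) _ ?_
    intro w
    rcases dr_prb_cases P hP {s | π (W s) = w} with h | h
    · refine Eq.trans ?_ (dr_cexp P Y _ _ h.ne' (hg₀ w h))
      refine Finset.sum_congr rfl fun s _ => ?_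
      by_cases hw : π (W s) = w <;> simp [hw]
    · refine Finset.sum_eq_zero fun s _ => ?_
      by_cases hw : π (W s) = w
      · simp [h s hw]
      · simp [hw]
  have e1 := L1 (fun p => (p.2 - g₀ (π p.1)) / ℓ (π p.1))
  have e2 := L2 (fun p => (p.2 - g₁ p.1) / (ℓ (π p.1) * lam₂ p.1))
  have e4 := L4 (fun w => lam₁ w / ℓ w - 1)
  have eβ : β = ∑ s, P s * β := by rw [← Finset.sum_mul, hPsum, one_mul]
  have key : (∑ s, P s * (R₂ s / (ℓ (π (W s)) * lam₂ (W s)) * (Y s - β)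
      - (R₁ s - ℓ (π (W s))) / ℓ (π (W s)) * (g₀ (π (W s)) - β)
      - (R₂ s - lam₂ (W s) * R₁ s) / (ℓ (π (W s)) * lam₂ (W s))
          * (g₁ (W s) - β))) =
    (∑ s, (P s * (R₁ s - lam₁ (π (W s)))) * ((Y s - g₀ (π (W s))) / ℓ (π (W s))))
    + (∑ s, (P s * (R₂ s - lam₂ (W s) * R₁ s)) *
        ((Y s - g₁ (W s)) / (ℓ (π (W s)) * lam₂ (W s))))
    + (∑ s, (P s * (Y s - g₀ (π (W s)))) * (lam₁ (π (W s)) / ℓ (π (W s)) - 1))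
    + (∑ s, P s * Y s) - ∑ s, P s * β := by
    rw [← Finset.sum_add_distrib, ← Finset.sum_add_distrib, ← Finset.sum_add_distrib,
      ← Finset.sum_sub_distrib]
    refine Finset.sum_congr rfl fun s _ => ?_
    have a := (hℓ (π (W s))).ne'
    have b := (hlam₂ (W s)).1.ne'
    field_simp
    ring
  unfold expv
  rw [key, ← eβ]
  simp only at e1 e2 e4
  rw [e1, e2, e4]
  ring
end

section
/- Define β := E[Y], g₀(w₀) := E[Y | W₀ = w₀], g₁(w) := E[Y | W̄₁ = w, R₁ = 1], V₀(w₀) := Var(Y | W₀ = w₀), V₂(w) := Var(Y | W̄₁ = w, R₁ = 1) (on the respective supports), and let U := R₂/(λ₁(W₀)·λ₂(W̄₁))·(Y − β) − ((R₁ − λ₁(W₀))/λ₁(W₀))·(g₀(W₀) − β) − ((R₂ − λ₂(W̄₁)·R₁)/(λ₁(W₀)·λ₂(W̄₁)))·(g₁(W̄₁) − β) be the efficient influence function of equation (3). Then Var(U) = Var(Y) + E[(1/λ₁(W₀) − 1)·V₀(W₀)] + E[(1/λ₂(W̄₁) − 1)·(1/λ₁(W₀))·V₂(W̄₁)], which is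 the variance formula of equation (4). -/
theorem eif_aux_fiber {S T : Type*} [Fintype S] [DecidableEq T] (Q : S → ℝ) (hQ : ∀ s, 0 ≤ Q s)
    (X : S → T) (D : S → ℝ)
    (h : ∀ v, 0 < (∑ s, if X s = v then Q s else 0) →
      (∑ s, if X s = v then Q s * D s else 0) = 0) (f : T → ℝ) :
    ∑ s, Q s * (D s * f (X s)) = 0 := by
  have h' : ∀ v, (∑ s, if X s = v then Q s * D s else 0) = 0 := by
    intro v
    have h0 : ∀ s ∈ Finset.univ, 0 ≤ (if X s = v then Q s else 0) := by
      intro s _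
      split_ifs
      · exact hQ s
      · exact le_rfl
    rcases (Finset.sum_nonneg h0).lt_or_eq with hp | hz
    · exact h v hp
    · have := (Finset.sum_eq_zero_iff_of_nonneg h0).1 hz.symm
      apply Finset.sum_eq_zero
      intro s hs
      have h1 := this s hs
      split_ifs with hx
      · rw [if_pos hx] at h1
        rw [h1, zero_mul]
      · rfl
  rw [← Finset.sum_fiberwise_of_maps_to (s := Finset.univ) (t := Finset.univ.image X) (g := X)
    (fun s hs => Finset.mem_image_of_mem X hs)]
  apply Finset.sum_eq_zero
  intro v _
  have h2 := h' v
  rw [← Finset.sum_filter] at h2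
  calc _ = ∑ s ∈ Finset.univ.filter (fun s => X s = v), (Q s * D s) * f v := by
        apply Finset.sum_congr rfl
        intro s hs
        rw [(Finset.mem_filter.1 hs).2]; ring
    _ = 0 := by rw [← Finset.sum_mul, h2, zero_mul]

open Classical in
theorem eif_aux_cexpv {S : Type*} [Fintype S] (P Z : S → ℝ) (A : Set S) (hA : 0 < prb P A) :
    ∑ s, A.indicator (fun s => P s * Z s) s = cexpv P Z A * ∑ s, A.indicator P s := by
  unfold cexpv
  change _ = _ / prb P A * prb P A
  field_simp

/-- variance of the efficient influence function, eq. (4):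
with `β = E[Y]`, `g₀(w₀) = E[Y ∣ W₀ = w₀]`, `g₁(w) = E[Y ∣ W̄₁ = w, R₁ = 1]`,
`V₀(w₀) = Var(Y ∣ W₀ = w₀)` and `V₂(w) = Var(Y ∣ W̄₁ = w, R₁ = 1)`, the
efficient influence function `U` of equation (3) satisfies
`Var(U) = Var(Y) + E[(1/λ₁(W₀) − 1)·V₀(W₀)]
        + E[(1/λ₂(W̄₁) − 1)·(1/λ₁(W₀))·V₂(W̄₁)]`. -/
theorem efficient_influence_function_variance
    {Ωs Ω₀ Ω : Type*} [Fintype Ωs] [Fintype Ω₀] [Fintype Ω]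
    [Nonempty Ω₀] [Nonempty Ω]
    (P : Ωs → ℝ) (hP : ∀ s, 0 ≤ P s) (hPsum : ∑ s, P s = 1)
    (π : Ω → Ω₀) (W : Ωs → Ω) (Y : Ωs → ℝ)
    (R₁ R₂ : Ωs → ℝ)
    (hR₁ : ∀ s, R₁ s = 0 ∨ R₁ s = 1) (hR₂ : ∀ s, R₂ s = 0 ∨ R₂ s = 1)
    (hR₂₁ : ∀ s, R₂ s ≤ R₁ s)
    (lam₁ : Ω₀ → ℝ) (lam₂ : Ω → ℝ)
    (hlam₁ : ∀ w₀, 0 < lam₁ w₀ ∧ lam₁ w₀ ≤ 1)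
    (hlam₂ : ∀ w, 0 < lam₂ w ∧ lam₂ w ≤ 1)
    (hMAR₁ : ∀ (w : Ω) (y : ℝ), 0 < prb P {s | W s = w ∧ Y s = y} →
      cprb P {s | R₁ s = 1} {s | W s = w ∧ Y s = y} = lam₁ (π w))
    (hMAR₂ : ∀ (w : Ω) (y : ℝ), 0 < prb P {s | W s = w ∧ Y s = y} →
      cprb P {s | R₂ s = 1} {s | R₁ s = 1 ∧ W s = w ∧ Y s = y} = lam₂ w)
    (β : ℝ) (hβ : β = expv P Y)
    (g₀ : Ω₀ → ℝ)
    (hg₀ : ∀ w₀, 0 < prb P {s | π (W s) = w₀} →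
      g₀ w₀ = cexpv P Y {s | π (W s) = w₀})
    (g₁ : Ω → ℝ)
    (hg₁ : ∀ w, 0 < prb P {s | W s = w ∧ R₁ s = 1} →
      g₁ w = cexpv P Y {s | W s = w ∧ R₁ s = 1})
    (V₀ : Ω₀ → ℝ)
    (hV₀ : ∀ w₀, 0 < prb P {s | π (W s) = w₀} →
      V₀ w₀ = cvarv P Y {s | π (W s) = w₀})
    (V₂ : Ω → ℝ)
    (hV₂ : ∀ w, 0 < prb P {s | W s = w ∧ R₁ s = 1} →
      V₂ w = cvarv P Y {s | W s = w ∧ R₁ s = 1})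
    (U : Ωs → ℝ)
    (hU : ∀ s, U s =
      R₂ s / (lam₁ (π (W s)) * lam₂ (W s)) * (Y s - β)
      - (R₁ s - lam₁ (π (W s))) / lam₁ (π (W s)) * (g₀ (π (W s)) - β)
      - (R₂ s - lam₂ (W s) * R₁ s) / (lam₁ (π (W s)) * lam₂ (W s))
          * (g₁ (W s) - β)) :
    varv P U = varv P Y
      + expv P (fun s => (1 / lam₁ (π (W s)) - 1) * V₀ (π (W s)))
      + expv P (fun s =>
          (1 / lam₂ (W s) - 1) * (1 / lam₁ (π (W s))) * V₂ (W s)) := by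
  classical
  have l1 : ∀ w, lam₁ w ≠ 0 := fun w => (hlam₁ w).1.ne'
  have l2 : ∀ w, lam₂ w ≠ 0 := fun w => (hlam₂ w).1.ne'
  have hQ1 : ∀ s, 0 ≤ P s * R₁ s := by
    intro s
    rcases hR₁ s with h | h <;> simp [h, hP s]
  have R11 : ∀ s, R₁ s * R₁ s = R₁ s := by
    intro s
    rcases hR₁ s with h | h <;> simp [h]
  have R22 : ∀ s, R₂ s * R₂ s = R₂ s := by
    intro s
    rcases hR₂ s with h | h <;> simp [h]
  have R21 : ∀ s, R₂ s * R₁ s = R₂ s := by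
    intro s
    have := hR₂₁ s
    rcases hR₁ s with h | h <;> rcases hR₂ s with h' | h' <;> simp [h, h'] at this ⊢
    linarith
  -- missing at random, first stage
  have F1 : ∀ w y, 0 < (∑ s, if (W s, Y s) = (w, y) then P s else 0) →
      (∑ s, if (W s, Y s) = (w, y) then P s * R₁ s else 0)
        = lam₁ (π w) * ∑ s, if (W s, Y s) = (w, y) then P s else 0 := by
    intro w y hp
    have e1 : prb P {s | W s = w ∧ Y s = y} = ∑ s, if (W s, Y s) = (w, y) then P s else 0 := by
      unfold prb
      apply Finset.sum_congr rfl
      intro s _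
      simp [Set.indicator_apply]
    have e2 : prb P ({s | R₁ s = 1} ∩ {s | W s = w ∧ Y s = y})
        = ∑ s, if (W s, Y s) = (w, y) then P s * R₁ s else 0 := by
      unfold prb
      apply Finset.sum_congr rfl
      intro s _
      rcases hR₁ s with h | h <;> simp [Set.indicator_apply, h]
    have := hMAR₁ w y (e1 ▸ hp)
    unfold cprb at this
    rw [e1, e2, div_eq_iff hp.ne'] at this
    exact this
  have F2 : ∀ w y, 0 < (∑ s, if (W s, Y s) = (w, y) then P s else 0) →
      (∑ s, if (W s, Y s) = (w, y) then P s * R₂ s else 0)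
        = lam₂ w * ∑ s, if (W s, Y s) = (w, y) then P s * R₁ s else 0 := by
    intro w y hp
    have e1 : prb P {s | W s = w ∧ Y s = y} = ∑ s, if (W s, Y s) = (w, y) then P s else 0 := by
      unfold prb
      apply Finset.sum_congr rfl
      intro s _
      simp [Set.indicator_apply]
    have e2 : prb P {s | R₁ s = 1 ∧ W s = w ∧ Y s = y}
        = ∑ s, if (W s, Y s) = (w, y) then P s * R₁ s else 0 := by
      unfold prb
      apply Finset.sum_congr rfl
      intro s _
      rcases hR₁ s with h | h <;> simp [Set.indicator_apply, h]
    have e3 : prb P ({s | R₂ s = 1} ∩ {s | R₁ s = 1 ∧ W s = w ∧ Y s = y})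
        = ∑ s, if (W s, Y s) = (w, y) then P s * R₂ s else 0 := by
      unfold prb
      apply Finset.sum_congr rfl
      intro s _
      have := R21 s
      rcases hR₁ s with h | h <;> rcases hR₂ s with h' | h' <;>
        simp [Set.indicator_apply, h, h'] at this ⊢
    have := hMAR₂ w y (e1 ▸ hp)
    unfold cprb at this
    have hp' : 0 < ∑ s, if (W s, Y s) = (w, y) then P s * R₁ s else 0 := by
      rw [F1 w y hp]
      exact mul_pos (hlam₁ _).1 hp
    rw [e2, e3, div_eq_iff hp'.ne'] at this
    exact this
  have A1 : ∀ f : Ω × ℝ → ℝ,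
      ∑ s, P s * ((R₁ s - lam₁ (π (W s))) * f (W s, Y s)) = 0 := by
    intro f
    apply eif_aux_fiber P hP (fun s => (W s, Y s)) (fun s => R₁ s - lam₁ (π (W s)))
    rintro ⟨w, y⟩ hp
    refine Eq.trans ?_ (sub_eq_zero.2 (F1 w y hp))
    rw [Finset.mul_sum, ← Finset.sum_sub_distrib]
    apply Finset.sum_congr rfl
    intro s _
    split_ifs with h
    · rw [(Prod.mk.inj h).1]; ring
    · ring
  have A2 : ∀ f : Ω × ℝ → ℝ,
      ∑ s, P s * ((R₂ s - lam₂ (W s) * R₁ s) * f (W s, Y s)) = 0 := by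
    intro f
    apply eif_aux_fiber P hP (fun s => (W s, Y s)) (fun s => R₂ s - lam₂ (W s) * R₁ s)
    rintro ⟨w, y⟩ hp
    refine Eq.trans ?_ (sub_eq_zero.2 (F2 w y hp))
    rw [Finset.mul_sum, ← Finset.sum_sub_distrib]
    apply Finset.sum_congr rfl
    intro s _
    split_ifs with h
    · rw [(Prod.mk.inj h).1]; ring
    · ring
  -- conditional moments given W and R₁ = 1
  have M1 : ∀ w, prb P {s | W s = w ∧ R₁ s = 1} = ∑ s, if W s = w then P s * R₁ s else 0 := by
    intro w
    unfold prb
    apply Finset.sum_congr rfl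
    intro s _
    rcases hR₁ s with h | h <;> simp [Set.indicator_apply, h]
  have M2 : ∀ w, 0 < prb P {s | W s = w ∧ R₁ s = 1} → ∀ Z : Ωs → ℝ,
      (∑ s, if W s = w then P s * R₁ s * Z s else 0)
        = cexpv P Z {s | W s = w ∧ R₁ s = 1} * ∑ s, if W s = w then P s * R₁ s else 0 := by
    intro w hp Z
    rw [← M1, prb, ← eif_aux_cexpv P Z _ hp]
    apply Finset.sum_congr rfl
    intro s _
    rcases hR₁ s with h | h <;> simp [Set.indicator_apply, h]
  have B1 : ∀ f : Ω → ℝ, ∑ s, P s * ((Y s - g₁ (W s)) * f (W s)) = 0 := by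
    intro f
    have h1 := eif_aux_fiber (fun s => P s * R₁ s) hQ1 W (fun s => Y s - g₁ (W s)) (by
      intro w hp
      rw [← M1] at hp
      refine Eq.trans ?_ (sub_eq_zero.2 (M2 w hp Y))
      rw [Finset.mul_sum, ← Finset.sum_sub_distrib, ← hg₁ w hp]
      apply Finset.sum_congr rfl
      intro s _
      split_ifs with h
      · rw [h]; ring
      · ring) (fun w => f w / lam₁ (π w))
    have h2 := A1 (fun p => (p.2 - g₁ p.1) * f p.1 / lam₁ (π p.1))
    refine Eq.trans ?_ (sub_eq_zero.2 (h1.trans h2.symm))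
    rw [← Finset.sum_sub_distrib]
    apply Finset.sum_congr rfl
    intro s _
    have := l1 (π (W s))
    field_simp
    ring
  have B2 : ∀ f : Ω → ℝ,
      ∑ s, P s * ((Y s ^ 2 - g₁ (W s) ^ 2 - V₂ (W s)) * f (W s)) = 0 := by
    intro f
    have h1 := eif_aux_fiber (fun s => P s * R₁ s) hQ1 W
      (fun s => Y s ^ 2 - g₁ (W s) ^ 2 - V₂ (W s)) (by
      intro w hp
      rw [← M1] at hp
      have hv := hV₂ w hp
      unfold cvarv at hv
      rw [← hg₁ w hp] at hv
      refine Eq.trans ?_ (sub_eq_zero.2 (M2 w hp (fun s => Y s ^ 2)))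
      rw [Finset.mul_sum,
        ← Finset.sum_sub_distrib]
      apply Finset.sum_congr rfl
      intro s _
      split_ifs with h
      · rw [h, hv]; ring
      · ring) (fun w => f w / lam₁ (π w))
    have h2 := A1 (fun p => (p.2 ^ 2 - g₁ p.1 ^ 2 - V₂ p.1) * f p.1 / lam₁ (π p.1))
    refine Eq.trans ?_ (sub_eq_zero.2 (h1.trans h2.symm))
    rw [← Finset.sum_sub_distrib]
    apply Finset.sum_congr rfl
    intro s _
    have := l1 (π (W s))
    field_simp
    ring
  -- conditional moments given W₀
  have N1 : ∀ w, prb P {s | π (W s) = w} = ∑ s, if π (W s) = w then P s else 0 := by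
    intro w
    unfold prb
    apply Finset.sum_congr rfl
    intro s _
    simp [Set.indicator_apply]
  have N2 : ∀ w, 0 < prb P {s | π (W s) = w} → ∀ Z : Ωs → ℝ,
      (∑ s, if π (W s) = w then P s * Z s else 0)
        = cexpv P Z {s | π (W s) = w} * ∑ s, if π (W s) = w then P s else 0 := by
    intro w hp Z
    rw [← N1, prb, ← eif_aux_cexpv P Z _ hp]
    apply Finset.sum_congr rfl
    intro s _
    simp [Set.indicator_apply]
  have C1 : ∀ f : Ω₀ → ℝ, ∑ s, P s * ((Y s - g₀ (π (W s))) * f (π (W s))) = 0 := by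
    intro f
    apply eif_aux_fiber P hP (fun s => π (W s)) (fun s => Y s - g₀ (π (W s)))
    intro w hp
    rw [← N1] at hp
    refine Eq.trans ?_ (sub_eq_zero.2 (N2 w hp Y))
    rw [Finset.mul_sum, ← Finset.sum_sub_distrib, ← hg₀ w hp]
    apply Finset.sum_congr rfl
    intro s _
    split_ifs with h
    · rw [h]; ring
    · ring
  have C2 : ∀ f : Ω₀ → ℝ,
      ∑ s, P s * ((Y s ^ 2 - g₀ (π (W s)) ^ 2 - V₀ (π (W s))) * f (π (W s))) = 0 := by
    intro f
    apply eif_aux_fiber P hP (fun s => π (W s))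
      (fun s => Y s ^ 2 - g₀ (π (W s)) ^ 2 - V₀ (π (W s)))
    intro w hp
    rw [← N1] at hp
    have hv := hV₀ w hp
    unfold cvarv at hv
    rw [← hg₀ w hp] at hv
    refine Eq.trans ?_ (sub_eq_zero.2 (N2 w hp (fun s => Y s ^ 2)))
    rw [Finset.mul_sum, ← Finset.sum_sub_distrib]
    apply Finset.sum_congr rfl
    intro s _
    split_ifs with h
    · rw [h, hv]; ring
    · ring
  have K : ∑ s, P s * (Y s - β) = 0 := by
    simp only [mul_sub, Finset.sum_sub_distrib, ← Finset.sum_mul, hPsum, hβ, expv]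
    ring
  have hU' : ∀ s, U s = R₂ s * ((Y s - g₁ (W s)) / (lam₁ (π (W s)) * lam₂ (W s)))
      + R₁ s * ((g₁ (W s) - g₀ (π (W s))) / lam₁ (π (W s))) + (g₀ (π (W s)) - β) := by
    intro s
    have h1 := l1 (π (W s))
    have h2 := l2 (W s)
    rw [hU s]
    field_simp
    ring
  have EU : expv P U = 0 := by
    have a1 := A1 (fun p => (p.2 - g₁ p.1) / lam₁ (π p.1) + (g₁ p.1 - g₀ (π p.1)) / lam₁ (π p.1))
    have a2 := A2 (fun p => (p.2 - g₁ p.1) / (lam₁ (π p.1) * lam₂ p.1))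
    have : expv P U = 0 + 0 + 0 := by
      nth_rewrite 1 [← a1]
      nth_rewrite 1 [← a2]
      rw [← K, ← Finset.sum_add_distrib, ← Finset.sum_add_distrib, expv]
      apply Finset.sum_congr rfl
      intro s _
      have h1 := l1 (π (W s))
      have h2 := l2 (W s)
      rw [hU' s]
      field_simp
      ring
    simpa using this
  -- second moment
  let a : Ω × ℝ → ℝ := fun p => (p.2 - g₁ p.1) / (lam₁ (π p.1) * lam₂ p.1)
  let b : Ω × ℝ → ℝ := fun p => (g₁ p.1 - g₀ (π p.1)) / lam₁ (π p.1)
  let c : Ω × ℝ → ℝ := fun p => g₀ (π p.1) - β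
  let q2 : Ω × ℝ → ℝ := fun p => a p ^ 2 + 2 * a p * b p + 2 * a p * c p
  let q1 : Ω × ℝ → ℝ := fun p => b p ^ 2 + 2 * b p * c p
  have a1 := A1 (fun p => lam₂ p.1 * q2 p + q1 p)
  have a2 := A2 q2
  have b1 := B1 (fun w => -2 * g₁ w / (lam₁ (π w) * lam₂ w) + 2 * g₁ w / lam₁ (π w))
  have b2 := B2 (fun w => 1 / (lam₁ (π w) * lam₂ w) - 1 / lam₁ (π w))
  have c1 := C1 (fun w => -2 * g₀ w / lam₁ w + 2 * g₀ w)
  have c2 := C2 (fun w => 1 / lam₁ w - 1)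
  have k2 : ∑ s, P s * (Y s - β) * (-2 * β) = 0 := by
    rw [← Finset.sum_mul, K, zero_mul]
  have kb : (expv P Y) ^ 2 = ∑ s, P s * β ^ 2 := by
    rw [← Finset.sum_mul, hPsum, hβ, one_mul]
  have hsq : ∀ s, U s ^ 2 = R₂ s * q2 (W s, Y s) + R₁ s * q1 (W s, Y s) + c (W s, Y s) ^ 2 := by
    intro s
    have e : U s = R₂ s * a (W s, Y s) + R₁ s * b (W s, Y s) + c (W s, Y s) := hU' s
    rw [e]
    simp only [q2, q1]
    linear_combination (a (W s, Y s)) ^ 2 * R22 s + (b (W s, Y s)) ^ 2 * R11 s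
      + 2 * a (W s, Y s) * b (W s, Y s) * R21 s
  unfold varv
  rw [EU, kb]
  unfold expv
  have key : (∑ s, P s * U s ^ 2) - (∑ s, P s * Y s ^ 2) + (∑ s, P s * β ^ 2)
      - (∑ s, P s * ((1 / lam₁ (π (W s)) - 1) * V₀ (π (W s))))
      - (∑ s, P s * ((1 / lam₂ (W s) - 1) * (1 / lam₁ (π (W s))) * V₂ (W s)))
      = (∑ s, P s * ((R₁ s - lam₁ (π (W s))) * (lam₂ (W s) * q2 (W s, Y s) + q1 (W s, Y s))))
      + (∑ s, P s * ((R₂ s - lam₂ (W s) * R₁ s) * q2 (W s, Y s)))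
      + (∑ s, P s * ((Y s - g₁ (W s)) * (-2 * g₁ (W s) / (lam₁ (π (W s)) * lam₂ (W s))
          + 2 * g₁ (W s) / lam₁ (π (W s)))))
      + (∑ s, P s * ((Y s ^ 2 - g₁ (W s) ^ 2 - V₂ (W s))
          * (1 / (lam₁ (π (W s)) * lam₂ (W s)) - 1 / lam₁ (π (W s)))))
      + (∑ s, P s * ((Y s - g₀ (π (W s))) * (-2 * g₀ (π (W s)) / lam₁ (π (W s))
          + 2 * g₀ (π (W s)))))
      + (∑ s, P s * ((Y s ^ 2 - g₀ (π (W s)) ^ 2 - V₀ (π (W s))) * (1 / lam₁ (π (W s)) - 1)))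
      + ∑ s, P s * (Y s - β) * (-2 * β) := by
    simp only [← Finset.sum_add_distrib, ← Finset.sum_sub_distrib]
    apply Finset.sum_congr rfl
    intro s _
    have h1 := l1 (π (W s))
    have h2 := l2 (W s)
    rw [hsq s]
    simp only [q2, q1, a, b, c]
    field_simp
    ring
  linarith [key, a1, a2, b1, b2, c1, c2, k2]
end

section
/- Define β := E[Y], g(w) := E[Y | W̄₁ = w], and V(w) := Var(Y | W̄₁ = w) for w in the support of W̄₁, and let U := R₂·Y/λ₂(W̄₁) − ((R₂ − λ₂(W̄₁))/λ₂(W̄₁))·g(W̄₁) − β be the one-phase efficient influence function of Section 2.1. Then E[U] = 0 and Var(U) = E[(g(W̄₁) − β)²] + E[V(W̄₁)/λ₂(W̄₁)], which is the one-phase variance formula V(λ₂) of Section 2.1. -/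
open Classical in
theorem aux_fib {S K : Type*} [Fintype S] (f : S → K) (a : S → ℝ) (c : K → ℝ)
    (h : ∀ k, ∑ s, Set.indicator {s | f s = k} a s = 0) :
    ∑ s, a s * c (f s) = 0 := by
  rw [← Finset.sum_fiberwise_of_maps_to (s := Finset.univ) (t := Finset.univ.image f) (g := f)
    (fun x _ => Finset.mem_image_of_mem f (Finset.mem_univ x))]
  apply Finset.sum_eq_zero
  intro k _
  have h1 : ∑ s ∈ Finset.univ.filter (fun s => f s = k), a s * c (f s)
      = (∑ s, Set.indicator {s | f s = k} a s) * c k := by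
    rw [Finset.sum_filter, Finset.sum_mul]
    refine Finset.sum_congr rfl fun s _ => ?_
    by_cases hs : f s = k <;> simp [Set.indicator, hs]
  rw [h1, h k, zero_mul]

theorem aux_zero {S : Type*} [Fintype S] (P : S → ℝ) (hP : ∀ s, 0 ≤ P s) (A : Set S)
    (Z : S → ℝ) (h : ¬ 0 < prb P A) : ∑ s, A.indicator (fun s => P s * Z s) s = 0 := by
  have hn : ∀ s ∈ Finset.univ, 0 ≤ A.indicator P s :=
    fun s _ => Set.indicator_nonneg (fun x _ => hP x) s
  have h0 : prb P A = 0 := le_antisymm (not_lt.mp h) (Finset.sum_nonneg hn)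
  have h1 := (Finset.sum_eq_zero_iff_of_nonneg hn).1 h0
  refine Finset.sum_eq_zero fun s hs => ?_
  by_cases hA : s ∈ A
  · have := h1 s hs
    simp only [Set.indicator_of_mem hA] at this ⊢
    rw [this, zero_mul]
  · simp [hA]

theorem aux_const {S : Type*} [Fintype S] (P : S → ℝ) (A : Set S)
    (Z D : S → ℝ) (c : ℝ) (hA : 0 < prb P A) (hc : c = cexpv P Z A)
    (hD : ∀ s ∈ A, D s = Z s - c) : ∑ s, A.indicator (fun s => P s * D s) s = 0 := by
  have h1 : ∑ s, A.indicator (fun s => P s * D s) s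
      = ∑ s, A.indicator (fun s => P s * Z s) s - c * prb P A := by
    rw [prb, Finset.mul_sum, ← Finset.sum_sub_distrib]
    refine Finset.sum_congr rfl fun s _ => ?_
    by_cases hs : s ∈ A
    · simp only [Set.indicator_of_mem hs, hD s hs]; ring
    · simp [hs]
  rw [h1, hc, cexpv, div_mul_cancel₀ _ hA.ne', sub_self]

/-- one-phase efficient influence function, Section 2.1:
with `β = E[Y]`, `g(w) = E[Y ∣ W̄₁ = w]` and `V(w) = Var(Y ∣ W̄₁ = w)`, the
one-phase efficient influence function
`U = R₂·Y/λ₂(W̄₁) − ((R₂ − λ₂(W̄₁))/λ₂(W̄₁))·g(W̄₁) − β`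
satisfies `E[U] = 0` and `Var(U) = E[(g(W̄₁) − β)²] + E[V(W̄₁)/λ₂(W̄₁)]`. -/
theorem one_phase_influence_function_variance
    {Ωs Ω : Type*} [Fintype Ωs] [Fintype Ω] [Nonempty Ω]
    (P : Ωs → ℝ) (hP : ∀ s, 0 ≤ P s) (hPsum : ∑ s, P s = 1)
    (W : Ωs → Ω) (Y : Ωs → ℝ)
    (R₂ : Ωs → ℝ) (hR₂ : ∀ s, R₂ s = 0 ∨ R₂ s = 1)
    (lam₂ : Ω → ℝ) (hlam₂ : ∀ w, 0 < lam₂ w ∧ lam₂ w ≤ 1)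
    (hMAR : ∀ (w : Ω) (y : ℝ), 0 < prb P {s | W s = w ∧ Y s = y} →
      cprb P {s | R₂ s = 1} {s | W s = w ∧ Y s = y} = lam₂ w)
    (β : ℝ) (hβ : β = expv P Y)
    (g : Ω → ℝ)
    (hg : ∀ w, 0 < prb P {s | W s = w} → g w = cexpv P Y {s | W s = w})
    (V : Ω → ℝ)
    (hV : ∀ w, 0 < prb P {s | W s = w} → V w = cvarv P Y {s | W s = w})
    (U : Ωs → ℝ)
    (hU : ∀ s, U s = R₂ s * Y s / lam₂ (W s)
      - (R₂ s - lam₂ (W s)) / lam₂ (W s) * g (W s) - β) :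
    expv P U = 0 ∧
    varv P U = expv P (fun s => (g (W s) - β) ^ 2)
      + expv P (fun s => V (W s) / lam₂ (W s)) := by
  have hA : ∀ F : Ω × ℝ → ℝ,
      ∑ s, (P s * (R₂ s - lam₂ (W s))) * F (W s, Y s) = 0 := by
    intro F
    refine aux_fib (fun s => (W s, Y s)) (fun s => P s * (R₂ s - lam₂ (W s))) F ?_
    rintro ⟨w, y⟩
    have he : {s | (W s, Y s) = (w, y)} = {s | W s = w ∧ Y s = y} := by
      ext s; simp
    rw [he]
    by_cases hp : 0 < prb P {s | W s = w ∧ Y s = y}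
    · refine aux_const P _ R₂ _ (lam₂ w) hp ?_ ?_
      · rw [← hMAR w y hp, cprb, cexpv, prb]
        congr 1
        refine Finset.sum_congr rfl fun s _ => ?_
        rw [Set.inter_comm, ← Set.indicator_indicator]
        have hi : Set.indicator {s | R₂ s = 1} P = fun s => P s * R₂ s := by
          funext t
          rcases hR₂ t with h | h <;> simp [Set.indicator, h]
        rw [hi]
      · rintro s ⟨h, _⟩
        rw [h]
    · exact aux_zero P hP _ _ hp
  have hB : ∀ F : Ω → ℝ, ∑ s, (P s * (Y s - g (W s))) * F (W s) = 0 := by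
    intro F
    refine aux_fib W (fun s => P s * (Y s - g (W s))) F ?_
    intro w
    by_cases hp : 0 < prb P {s | W s = w}
    · refine aux_const P _ Y _ (g w) hp (hg w hp) ?_
      intro s h
      rw [Set.mem_ofPred_eq] at h
      rw [h]
    · exact aux_zero P hP _ _ hp
  have hC : ∀ F : Ω → ℝ,
      ∑ s, (P s * (Y s ^ 2 - (g (W s) ^ 2 + V (W s)))) * F (W s) = 0 := by
    intro F
    refine aux_fib W (fun s => P s * (Y s ^ 2 - (g (W s) ^ 2 + V (W s)))) F ?_
    intro w
    by_cases hp : 0 < prb P {s | W s = w}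
    · refine aux_const P _ (fun s => Y s ^ 2) _ (g w ^ 2 + V w) hp ?_ ?_
      · rw [hV w hp, hg w hp, cvarv]; ring
      · intro s h
        rw [Set.mem_ofPred_eq] at h
        rw [h]
    · exact aux_zero P hP _ _ hp
  have hE : expv P U = 0 := by
    have h1 := hA (fun p => (p.2 - g p.1) / lam₂ p.1)
    have h2 : expv P U = ∑ s, (P s * (R₂ s - lam₂ (W s))) * ((Y s - g (W s)) / lam₂ (W s))
        + (expv P Y - (∑ s, P s) * β) := by
      rw [expv, expv, Finset.sum_mul, ← Finset.sum_sub_distrib, ← Finset.sum_add_distrib]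
      refine Finset.sum_congr rfl fun s _ => ?_
      have := (hlam₂ (W s)).1.ne'
      rw [hU]
      field_simp
      ring
    rw [h2, h1, hPsum, hβ]; ring
  refine ⟨hE, ?_⟩
  rw [varv, hE]
  have h1 := hA (fun p => (p.2 - g p.1) ^ 2 / lam₂ p.1 ^ 2
    + 2 * (p.2 - g p.1) * (g p.1 - β) / lam₂ p.1)
  have h2 := hB (fun w => 2 * (g w - β) - 2 * g w / lam₂ w)
  have h3 := hC (fun w => 1 / lam₂ w)
  have h4 : expv P (fun s => U s ^ 2) = (expv P (fun s => (g (W s) - β) ^ 2)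
      + expv P (fun s => V (W s) / lam₂ (W s))) + (0 + 0 + 0) := by
    nth_rewrite 1 [← h1]
    nth_rewrite 1 [← h2]
    nth_rewrite 1 [← h3]
    simp only [expv, ← Finset.sum_add_distrib]
    refine Finset.sum_congr rfl fun s _ => ?_
    have := (hlam₂ (W s)).1.ne'
    rw [hU]
    rcases hR₂ s with h | h <;> rw [h] <;> field_simp <;> ring
  rw [h4]; ring
end

section
/- For every w₀ ∈ Ω₀ with P(W₀ = w₀) > 0, E[Y | W₀ = w₀] = E[ h(W̄₁) | W₀ = w₀, R₁ = 1 ], where h(w) := E[Y | W̄₁ = w, R₂ = 1] for w in the support of W̄₁ (all conditioning events have positive probability because λ₁ > 0 and λ₂ > 0). That is, the population regression E(Y | W₀) can be recovered by first regressing Y on W̄₁ within the second-phase sample and then averaging over W̄₁ within the first-phase sample (the identity of Appendix C). -/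
theorem aux_fiber_s11 {S β : Type*} [Fintype S] (V : S → β) (d : S → ℝ) (f : β → ℝ)
    (hd : ∀ v, ∑ s, {s | V s = v}.indicator d s = 0) : ∑ s, d s * f (V s) = 0 := by
  classical
  rw [← Finset.sum_fiberwise_of_maps_to (s := Finset.univ) (t := Finset.univ.image V) (g := V)
    (fun s _ => Finset.mem_image_of_mem V (Finset.mem_univ s))]
  apply Finset.sum_eq_zero
  intro v _
  have h1 := hd v
  simp only [Set.indicator_apply, Set.mem_setOf_eq] at h1
  rw [← Finset.sum_filter] at h1
  calc ∑ s with V s = v, d s * f (V s) = ∑ s with V s = v, d s * f v := by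
        apply Finset.sum_congr rfl
        intro s hs
        rw [(Finset.mem_filter.mp hs).2]
    _ = 0 := by rw [← Finset.sum_mul, h1, zero_mul]

theorem aux_null {S : Type*} [Fintype S] (P : S → ℝ) (hP : ∀ s, 0 ≤ P s) (A : Set S)
    (hA : ¬ 0 < prb P A) : ∀ s ∈ A, P s = 0 := by
  intro s hs
  have h0 : prb P A = 0 :=
    le_antisymm (not_lt.mp hA) (Finset.sum_nonneg fun s _ => Set.indicator_nonneg (fun s _ => hP s) s)
  have := (Finset.sum_eq_zero_iff_of_nonneg
    (fun s _ => Set.indicator_nonneg (fun s _ => hP s) s)).mp h0 s (Finset.mem_univ s)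
  rwa [Set.indicator_of_mem hs] at this

/-- weighted replacement of a selection indicator by its propensity. -/
theorem aux_sel {S β : Type*} [Fintype S] (P : S → ℝ) (hP : ∀ s, 0 ≤ P s) (V : S → β)
    (R : S → ℝ) (hR : ∀ s, R s = 0 ∨ R s = 1) (g : β → ℝ)
    (hg : ∀ v, 0 < prb P {s | V s = v} →
      prb P ({s | R s = 1} ∩ {s | V s = v}) = g v * prb P {s | V s = v}) (f : β → ℝ) :
    ∑ s, P s * R s * f (V s) = ∑ s, P s * g (V s) * f (V s) := by
  classical
  have := aux_fiber_s11 V (fun s => P s * R s - P s * g (V s)) f (by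
    intro v
    by_cases hv : 0 < prb P {s | V s = v}
    · have h1 := hg v hv
      unfold prb at h1
      rw [Finset.mul_sum, ← sub_eq_zero, ← Finset.sum_sub_distrib] at h1
      rw [← h1]
      apply Finset.sum_congr rfl
      intro s _
      by_cases hs : V s = v
      · rcases hR s with h | h <;> simp [Set.indicator_apply, hs, h, mul_comm]
      · simp [Set.indicator_apply, hs]
    · apply Finset.sum_eq_zero
      intro s _
      by_cases hs : V s = v
      · have := aux_null P hP _ hv s hs
        simp [Set.indicator_apply, this]
      · simp [Set.indicator_apply, hs])
  simp only [sub_mul, Finset.sum_sub_distrib] at this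
  linarith

/-- identity of Appendix C: for every `w₀` in the support of
`W₀`, `E[Y ∣ W₀ = w₀] = E[h(W̄₁) ∣ W₀ = w₀, R₁ = 1]` where
`h(w) = E[Y ∣ W̄₁ = w, R₂ = 1]`: the population regression `E(Y ∣ W₀)` can be
recovered by regressing `Y` on `W̄₁` in the second-phase sample and averaging
over `W̄₁` within the first-phase sample. -/
theorem population_regression_recovered
    {Ωs Ω₀ Ω : Type*} [Fintype Ωs] [Fintype Ω₀] [Fintype Ω]
    [Nonempty Ω₀] [Nonempty Ω]
    (P : Ωs → ℝ) (hP : ∀ s, 0 ≤ P s) (hPsum : ∑ s, P s = 1)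
    (π : Ω → Ω₀) (W : Ωs → Ω) (Y : Ωs → ℝ)
    (R₁ R₂ : Ωs → ℝ)
    (hR₁ : ∀ s, R₁ s = 0 ∨ R₁ s = 1) (hR₂ : ∀ s, R₂ s = 0 ∨ R₂ s = 1)
    (hR₂₁ : ∀ s, R₂ s ≤ R₁ s)
    (lam₁ : Ω₀ → ℝ) (lam₂ : Ω → ℝ)
    (hlam₁ : ∀ w₀, 0 < lam₁ w₀ ∧ lam₁ w₀ ≤ 1)
    (hlam₂ : ∀ w, 0 < lam₂ w ∧ lam₂ w ≤ 1)
    (hMAR₁ : ∀ (w : Ω) (y : ℝ), 0 < prb P {s | W s = w ∧ Y s = y} →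
      cprb P {s | R₁ s = 1} {s | W s = w ∧ Y s = y} = lam₁ (π w))
    (hMAR₂ : ∀ (w : Ω) (y : ℝ), 0 < prb P {s | W s = w ∧ Y s = y} →
      cprb P {s | R₂ s = 1} {s | R₁ s = 1 ∧ W s = w ∧ Y s = y} = lam₂ w)
    (h : Ω → ℝ)
    (hh : ∀ w, 0 < prb P {s | W s = w} →
      h w = cexpv P Y {s | W s = w ∧ R₂ s = 1}) :
    ∀ w₀ : Ω₀, 0 < prb P {s | π (W s) = w₀} →
      cexpv P Y {s | π (W s) = w₀}
        = cexpv P (fun s => h (W s)) {s | π (W s) = w₀ ∧ R₁ s = 1} := by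
  classical
  have pos1 : ∀ w y, 0 < prb P {s | W s = w ∧ Y s = y} →
      prb P ({s | R₁ s = 1} ∩ {s | W s = w ∧ Y s = y})
        = lam₁ (π w) * prb P {s | W s = w ∧ Y s = y} := by
    intro w y hv
    have h1 := hMAR₁ w y hv
    unfold cprb at h1
    rwa [div_eq_iff hv.ne'] at h1
  have E1 : ∀ f : Ω × ℝ → ℝ, ∑ s, P s * R₁ s * f (W s, Y s)
      = ∑ s, P s * lam₁ (π (W s)) * f (W s, Y s) := by
    intro f
    refine aux_sel P hP (fun s => (W s, Y s)) R₁ hR₁ (fun v => lam₁ (π v.1)) ?_ f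
    rintro ⟨w, y⟩ hv
    simp only [Prod.mk.injEq] at hv ⊢
    exact pos1 w y hv
  have E2 : ∀ f : Ω × ℝ → ℝ, ∑ s, P s * R₂ s * f (W s, Y s)
      = ∑ s, P s * (lam₁ (π (W s)) * lam₂ (W s)) * f (W s, Y s) := by
    intro f
    refine aux_sel P hP (fun s => (W s, Y s)) R₂ hR₂ (fun v => lam₁ (π v.1) * lam₂ v.1) ?_ f
    rintro ⟨w, y⟩ hv
    simp only [Prod.mk.injEq] at hv ⊢
    have h1 := pos1 w y hv
    have h2 := hMAR₂ w y hv
    have e1 : {s | R₁ s = 1 ∧ W s = w ∧ Y s = y} = {s | R₁ s = 1} ∩ {s | W s = w ∧ Y s = y} := rfl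
    have e2 : {s | R₂ s = 1} ∩ {s | R₁ s = 1 ∧ W s = w ∧ Y s = y}
        = {s | R₂ s = 1} ∩ {s | W s = w ∧ Y s = y} := by
      ext s
      simp only [Set.mem_inter_iff, Set.mem_setOf_eq]
      constructor
      · tauto
      · rintro ⟨a, b⟩
        refine ⟨a, ?_, b⟩
        have := hR₂₁ s
        rcases hR₁ s with h | h
        · linarith
        · exact h
    have hp : 0 < lam₁ (π w) * prb P {s | W s = w ∧ Y s = y} := mul_pos (hlam₁ _).1 hv
    unfold cprb at h2
    rw [e2, e1, h1, div_eq_iff hp.ne'] at h2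
    rw [h2]; ring
  have K : ∀ w, ∑ s, {s | W s = w}.indicator (fun s => P s * (Y s - h (W s))) s = 0 := by
    intro w
    by_cases hw : 0 < prb P {s | W s = w}
    · have hl : 0 < lam₁ (π w) * lam₂ w := mul_pos (hlam₁ _).1 (hlam₂ _).1
      have d : prb P {s | W s = w ∧ R₂ s = 1} = lam₁ (π w) * lam₂ w * prb P {s | W s = w} := by
        have := E2 (fun v => if v.1 = w then 1 else 0)
        unfold prb
        rw [Finset.mul_sum]
        convert this using 2 with s _ s _
        · by_cases hs : W s = w <;> rcases hR₂ s with h | h <;> simp [Set.indicator_apply, hs, h]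
        · by_cases hs : W s = w <;> simp [Set.indicator_apply, hs, mul_comm]
      have n : ∑ s, {s | W s = w ∧ R₂ s = 1}.indicator (fun s => P s * Y s) s
          = lam₁ (π w) * lam₂ w * ∑ s, {s | W s = w}.indicator (fun s => P s * Y s) s := by
        have := E2 (fun v => if v.1 = w then v.2 else 0)
        rw [Finset.mul_sum]
        convert this using 2 with s _ s _
        · by_cases hs : W s = w <;> rcases hR₂ s with h | h <;> simp [Set.indicator_apply, hs, h]
        · by_cases hs : W s = w <;> simp [Set.indicator_apply, hs]
          ring
      have h1 := hh w hw
      unfold cexpv at h1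
      rw [d, n, mul_div_mul_left _ _ hl.ne', eq_div_iff hw.ne'] at h1
      unfold prb at h1
      rw [Finset.mul_sum, eq_comm, ← sub_eq_zero, ← Finset.sum_sub_distrib] at h1
      rw [← h1]
      apply Finset.sum_congr rfl
      intro s _
      by_cases hs : W s = w <;> simp [Set.indicator_apply, hs]
      ring
    · apply Finset.sum_eq_zero
      intro s _
      by_cases hs : W s = w
      · have := aux_null P hP _ hw s hs
        simp [Set.indicator_apply, this]
      · simp [Set.indicator_apply, hs]
  intro w₀ h₀
  have M := aux_fiber_s11 W _ (fun w => if π w = w₀ then 1 else 0) K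
  have d : prb P {s | π (W s) = w₀ ∧ R₁ s = 1} = lam₁ w₀ * prb P {s | π (W s) = w₀} := by
    have := E1 (fun v => if π v.1 = w₀ then 1 else 0)
    unfold prb
    rw [Finset.mul_sum]
    convert this using 2 with s _ s _
    · by_cases hs : π (W s) = w₀ <;> rcases hR₁ s with h | h <;> simp [Set.indicator_apply, hs, h]
    · by_cases hs : π (W s) = w₀ <;> simp [Set.indicator_apply, hs, mul_comm]
  have n : ∑ s, {s | π (W s) = w₀ ∧ R₁ s = 1}.indicator (fun s => P s * h (W s)) s
      = lam₁ w₀ * ∑ s, {s | π (W s) = w₀}.indicator (fun s => P s * Y s) s := by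
    have := E1 (fun v => if π v.1 = w₀ then h v.1 else 0)
    have t : ∑ s, {s | π (W s) = w₀}.indicator (fun s => P s * Y s) s
        = ∑ s, {s | π (W s) = w₀}.indicator (fun s => P s * h (W s)) s := by
      rw [← sub_eq_zero, ← Finset.sum_sub_distrib, ← M]
      apply Finset.sum_congr rfl
      intro s _
      by_cases hs : π (W s) = w₀ <;> simp [Set.indicator_apply, hs]
      ring
    rw [t, Finset.mul_sum]
    convert this using 2 with s _ s _
    · by_cases hs : π (W s) = w₀ <;> rcases hR₁ s with h | h <;> simp [Set.indicator_apply, hs, h]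
    · by_cases hs : π (W s) = w₀ <;> simp [Set.indicator_apply, hs]
      ring
  unfold cexpv
  rw [d, n, mul_div_mul_left _ _ (hlam₁ w₀).1.ne']
end

section
/- For every w ∈ Ω with P(W̄₁ = w) > 0, E[Y | W̄₁ = w, R₁ = 1] = E[Y | W̄₁ = w, R₂ = 1] (both conditioning events have positive probability because λ₁ > 0 and λ₂ > 0). That is, under missing-at-random second-phase selection, the regression of Y on W̄₁ in the first-phase sample coincides with the regression of Y on W̄₁ in the second-phase sample, so E(Y | W̄₁, R₁ = 1) can be estimated from second-phase data (the identity of Appendix C). -/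
open Classical in
theorem fiber_aux {Ωs : Type*} [Fintype Ωs] (P Y : Ωs → ℝ) (f : ℝ → ℝ) (A : Set Ωs) :
    ∑ s, A.indicator (fun s => P s * f (Y s)) s
      = ∑ y ∈ Finset.univ.image Y, f y * prb P (A ∩ {s | Y s = y}) := by
  rw [← Finset.sum_fiberwise_of_maps_to (s := Finset.univ) (t := Finset.univ.image Y) (g := Y)
    (fun s hs => Finset.mem_image_of_mem Y hs)]
  refine Finset.sum_congr rfl fun y _ => ?_
  rw [prb, Finset.mul_sum, Finset.sum_filter]
  refine Finset.sum_congr rfl fun s _ => ?_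
  by_cases h : Y s = y <;> by_cases hA : s ∈ A <;> simp [Set.indicator, h, hA, mul_comm]

theorem prb_mono_aux {Ωs : Type*} [Fintype Ωs] (P : Ωs → ℝ) (hP : ∀ s, 0 ≤ P s)
    {A B : Set Ωs} (h : A ⊆ B) : prb P A ≤ prb P B :=
  Finset.sum_le_sum fun s _ => Set.indicator_le_indicator_of_subset h hP s

theorem prb_nonneg_aux {Ωs : Type*} [Fintype Ωs] (P : Ωs → ℝ) (hP : ∀ s, 0 ≤ P s)
    (A : Set Ωs) : 0 ≤ prb P A :=
  Finset.sum_nonneg fun s _ => Set.indicator_nonneg (fun s _ => hP s) s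

/-- identity of Appendix C: under missing-at-random
second-phase selection, for every `w` in the support of `W̄₁`,
`E[Y ∣ W̄₁ = w, R₁ = 1] = E[Y ∣ W̄₁ = w, R₂ = 1]`, so the first-phase
regression of `Y` on `W̄₁` can be estimated from second-phase data. -/
theorem first_phase_regression_equals_second_phase
    {Ωs Ω₀ Ω : Type*} [Fintype Ωs] [Fintype Ω₀] [Fintype Ω]
    [Nonempty Ω₀] [Nonempty Ω]
    (P : Ωs → ℝ) (hP : ∀ s, 0 ≤ P s) (hPsum : ∑ s, P s = 1)
    (π : Ω → Ω₀) (W : Ωs → Ω) (Y : Ωs → ℝ)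
    (R₁ R₂ : Ωs → ℝ)
    (hR₁ : ∀ s, R₁ s = 0 ∨ R₁ s = 1) (hR₂ : ∀ s, R₂ s = 0 ∨ R₂ s = 1)
    (hR₂₁ : ∀ s, R₂ s ≤ R₁ s)
    (lam₁ : Ω₀ → ℝ) (lam₂ : Ω → ℝ)
    (hlam₁ : ∀ w₀, 0 < lam₁ w₀ ∧ lam₁ w₀ ≤ 1)
    (hlam₂ : ∀ w, 0 < lam₂ w ∧ lam₂ w ≤ 1)
    (hMAR₁ : ∀ (w : Ω) (y : ℝ), 0 < prb P {s | W s = w ∧ Y s = y} →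
      cprb P {s | R₁ s = 1} {s | W s = w ∧ Y s = y} = lam₁ (π w))
    (hMAR₂ : ∀ (w : Ω) (y : ℝ), 0 < prb P {s | W s = w ∧ Y s = y} →
      cprb P {s | R₂ s = 1} {s | R₁ s = 1 ∧ W s = w ∧ Y s = y} = lam₂ w)
 :
    ∀ w : Ω, 0 < prb P {s | W s = w} →
      cexpv P Y {s | W s = w ∧ R₁ s = 1}
        = cexpv P Y {s | W s = w ∧ R₂ s = 1} := by
  intro w _
  have hl := (hlam₂ w).1
  have key : ∀ y, prb P ({s | W s = w ∧ R₂ s = 1} ∩ {s | Y s = y})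
      = lam₂ w * prb P ({s | W s = w ∧ R₁ s = 1} ∩ {s | Y s = y}) := by
    intro y
    rcases (prb_nonneg_aux P hP {s | W s = w ∧ Y s = y}).eq_or_lt with h | h
    · have h0 : ∀ A : Set Ωs, A ⊆ {s | W s = w ∧ Y s = y} → prb P A = 0 := fun A hA =>
        le_antisymm (h ▸ prb_mono_aux P hP hA) (prb_nonneg_aux P hP A)
      rw [h0 _ (fun s hs => ⟨hs.1.1, hs.2⟩), h0 _ (fun s hs => ⟨hs.1.1, hs.2⟩), mul_zero]
    · have h2 := hMAR₂ w y h
      have e1 : {s | W s = w ∧ R₁ s = 1} ∩ {s | Y s = y}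
          = {s | R₁ s = 1 ∧ W s = w ∧ Y s = y} := by
        ext s; simp only [Set.mem_inter_iff, Set.mem_setOf_eq]; tauto
      have e2 : {s | W s = w ∧ R₂ s = 1} ∩ {s | Y s = y}
          = {s | R₂ s = 1} ∩ {s | R₁ s = 1 ∧ W s = w ∧ Y s = y} := by
        ext s
        have h21 : R₂ s = 1 → R₁ s = 1 := by
          intro hs
          rcases hR₁ s with h' | h'
          · have := hR₂₁ s
            linarith
          · exact h'
        simp only [Set.mem_inter_iff, Set.mem_setOf_eq]; tauto
      rw [e1, e2]
      unfold cprb at h2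
      have hd : prb P {s | R₁ s = 1 ∧ W s = w ∧ Y s = y} ≠ 0 := by
        intro h0
        rw [h0, div_zero] at h2
        exact hl.ne h2
      exact (div_eq_iff hd).1 h2
  have main : ∀ f : ℝ → ℝ,
      ∑ s, ({s | W s = w ∧ R₂ s = 1} : Set Ωs).indicator (fun s => P s * f (Y s)) s
      = lam₂ w * ∑ s, ({s | W s = w ∧ R₁ s = 1} : Set Ωs).indicator (fun s => P s * f (Y s)) s := by
    intro f
    rw [fiber_aux, fiber_aux, Finset.mul_sum]
    refine Finset.sum_congr rfl fun y _ => ?_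
    rw [key]; ring
  have hn := main (fun y => y)
  have hd := main (fun _ => 1)
  simp only [mul_one] at hd
  unfold cexpv prb
  rw [hn, hd, mul_div_mul_left _ _ hl.ne']
end

section
/- For every function g : Ω → ℝ (an arbitrary, possibly misspecified outcome model) and every β ∈ ℝ, E[ R₂·Y/λ₂(W̄₁) − ((R₂ − λ₂(W̄₁))/λ₂(W̄₁))·g(W̄₁) − β ] = E[Y] − β. In particular, the one-phase estimating function of Section 2.1 has mean zero if and only if β = E[Y], regardless of whether g equals the true conditional mean E(Y | W̄₁). -/
theorem resid_sum_zero
    {Ωs Ω : Type*} [Fintype Ωs]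
    (P : Ωs → ℝ) (hP : ∀ s, 0 ≤ P s)
    (W : Ωs → Ω) (Y : Ωs → ℝ)
    (R₂ : Ωs → ℝ) (hR₂ : ∀ s, R₂ s = 0 ∨ R₂ s = 1)
    (lam₂ : Ω → ℝ)
    (hMAR : ∀ (w : Ω) (y : ℝ), 0 < prb P {s | W s = w ∧ Y s = y} →
      cprb P {s | R₂ s = 1} {s | W s = w ∧ Y s = y} = lam₂ w)
    (h : Ω → ℝ → ℝ) :
    ∑ s, P s * (R₂ s - lam₂ (W s)) * h (W s) (Y s) = 0 := by
  classical
  rw [← Finset.sum_fiberwise_of_maps_to (s := Finset.univ)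
    (t := Finset.univ.image (fun s => (W s, Y s))) (g := fun s => (W s, Y s))
    (fun s _ => Finset.mem_image_of_mem _ (Finset.mem_univ s))]
  apply Finset.sum_eq_zero
  rintro ⟨w, y⟩ _
  have e : ∀ s ∈ Finset.univ.filter (fun s => (W s, Y s) = (w, y)),
      P s * (R₂ s - lam₂ (W s)) * h (W s) (Y s) = (P s * R₂ s - P s * lam₂ w) * h w y := by
    intro s hs
    simp only [Finset.mem_filter, Prod.mk.injEq] at hs
    rw [hs.2.1, hs.2.2]; ring
  rw [Finset.sum_congr rfl e, ← Finset.sum_mul, Finset.sum_sub_distrib, ← Finset.sum_mul]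
  have hA : prb P {s | W s = w ∧ Y s = y}
      = ∑ s ∈ Finset.univ.filter (fun s => (W s, Y s) = (w, y)), P s := by
    unfold prb
    rw [Finset.sum_filter]
    refine Finset.sum_congr rfl fun s _ => ?_
    simp [Set.indicator_apply]
  have hB : prb P ({s | R₂ s = 1} ∩ {s | W s = w ∧ Y s = y})
      = ∑ s ∈ Finset.univ.filter (fun s => (W s, Y s) = (w, y)), P s * R₂ s := by
    unfold prb
    rw [Finset.sum_filter]
    refine Finset.sum_congr rfl fun s _ => ?_
    rcases hR₂ s with h0 | h0 <;> simp [Set.indicator_apply, h0]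
  have hnn : 0 ≤ prb P {s | W s = w ∧ Y s = y} := by
    rw [hA]; exact Finset.sum_nonneg fun s _ => hP s
  rcases hnn.lt_or_eq with hpos | hz
  · have := hMAR w y hpos
    unfold cprb at this
    rw [div_eq_iff hpos.ne'] at this
    rw [← hA, ← hB, this]; ring
  · rw [hA] at hz
    have hz' := (Finset.sum_eq_zero_iff_of_nonneg fun s _ => hP s).1 hz.symm
    rw [← hz, Finset.sum_eq_zero fun s hs => by rw [hz' s hs, zero_mul]]
    ring

/-- unbiasedness of the one-phase estimating function of
Section 2.1: for an arbitrary (possibly misspecified) outcome model `g` and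
every `β`, `E[R₂·Y/λ₂(W̄₁) − ((R₂ − λ₂(W̄₁))/λ₂(W̄₁))·g(W̄₁) − β] = E[Y] − β`;
in particular the estimating function has mean zero iff `β = E[Y]`. -/
theorem one_phase_estimating_function_unbiased
    {Ωs Ω : Type*} [Fintype Ωs] [Fintype Ω] [Nonempty Ω]
    (P : Ωs → ℝ) (hP : ∀ s, 0 ≤ P s) (hPsum : ∑ s, P s = 1)
    (W : Ωs → Ω) (Y : Ωs → ℝ)
    (R₂ : Ωs → ℝ) (hR₂ : ∀ s, R₂ s = 0 ∨ R₂ s = 1)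
    (lam₂ : Ω → ℝ) (hlam₂ : ∀ w, 0 < lam₂ w ∧ lam₂ w ≤ 1)
    (hMAR : ∀ (w : Ω) (y : ℝ), 0 < prb P {s | W s = w ∧ Y s = y} →
      cprb P {s | R₂ s = 1} {s | W s = w ∧ Y s = y} = lam₂ w)
    (g : Ω → ℝ) (β : ℝ) :
    expv P (fun s => R₂ s * Y s / lam₂ (W s)
        - (R₂ s - lam₂ (W s)) / lam₂ (W s) * g (W s) - β)
      = expv P Y - β ∧
    (expv P (fun s => R₂ s * Y s / lam₂ (W s)
        - (R₂ s - lam₂ (W s)) / lam₂ (W s) * g (W s) - β) = 0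
      ↔ β = expv P Y) := by
  have key : expv P (fun s => R₂ s * Y s / lam₂ (W s)
        - (R₂ s - lam₂ (W s)) / lam₂ (W s) * g (W s) - β)
      = expv P Y - β := by
    have h0 := resid_sum_zero P hP W Y R₂ hR₂ lam₂ hMAR (fun w y => (y - g w) / lam₂ w)
    have hb : β = ∑ s, P s * β := by rw [← Finset.sum_mul, hPsum, one_mul]
    unfold expv
    conv_rhs => rw [hb]
    rw [← Finset.sum_sub_distrib, ← sub_eq_zero, ← Finset.sum_sub_distrib, ← h0]
    refine Finset.sum_congr rfl fun s _ => ?_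
    have := (hlam₂ (W s)).1.ne'
    field_simp
    ring
  refine ⟨key, ?_⟩
  rw [key, sub_eq_zero]
  exact eq_comm
end
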